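/- arXiv:2510.01926 — 2 statements merged into one kernel-verified Lean document; each statement's English description precedes it below -/
import Mathlib

section
/- Let X ⊂ ℝ^{d+1} be the image of an injective continuous map from the d-sphere S^d, with d > 0. Then the complement ℝ^{d+1} \ X has exactly two connected components, exactly one of which is bounded, and X is the topological frontier (boundary) of each component. -/
open Metric

section JordanBrouwer

open Set MeasureTheory Filter Module
open scoped Topology ContDiff

variable {ι E : Type*} [Fintype ι] [DecidableEq ι] [NormedAddCommGroup E] [NormedSpace ℝ E]

/-- Cramer's rule. -/
theorem Module.Basis.sum_det_update_mul (b : Basis ι ℝ E) (w : ι → E) (h : E) (L : E →ₗ[ℝ] ℝ) :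
    ∑ j, b.det (Function.update w j h) * L (w j) = b.det w * L h := by
  have key : ∑ j, b.det (Function.update w j h) • w j = b.det w • h := by
    refine b.ext_elem fun i => ?_
    have := congrFun (Matrix.mulVec_cramer (b.toMatrix w) (b.repr h)) i
    simp only [Matrix.mulVec, dotProduct, Matrix.cramer_apply, ← b.toMatrix_update] at this
    simp only [map_sum, map_smul, Finsupp.coe_finsetSum, Finset.sum_apply, Finsupp.coe_smul,
      Pi.smul_apply, smul_eq_mul, Basis.det_apply]
    simpa [Basis.toMatrix_apply, mul_comm] using this
  have := congrArg L key
  simpa using this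

/-- The antisymmetry which makes the columns of the cofactor matrix of a Jacobian
divergence free. -/
theorem Module.Basis.sum_det_update_update_eq_zero (b : Basis ι ℝ E) (w : ι → E) (h : E)
    (S : ι → ι → E) (hS : ∀ j k, S j k = S k j) :
    ∑ j, ∑ k ∈ Finset.univ.erase j,
      b.det (Function.update (Function.update w j h) k (S j k)) = 0 := by
  classical
  set T : ι → ι → ℝ := fun j k =>
    if k = j then 0 else b.det (Function.update (Function.update w j h) k (S j k)) with hT
  have hT' : ∀ j k, T j k = - T k j := by
    intro j k
    by_cases hjk : k = j
    · simp [hT, hjk]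
    · have hkj : j ≠ k := fun h => hjk h.symm
      simp only [hT, hjk, hkj, if_false]
      rw [← b.det.map_swap _ hjk, hS j k]
      congr 1
      ext1 i
      by_cases hik : i = k
      · subst hik; simp
      · by_cases hij : i = j
        · subst hij; simp [hkj, hjk]
        · simp [Equiv.swap_apply_of_ne_of_ne hik hij, hik, hij]
  have h1 : ∑ j, ∑ k ∈ Finset.univ.erase j,
      b.det (Function.update (Function.update w j h) k (S j k)) = ∑ j, ∑ k, T j k := by
    refine Finset.sum_congr rfl fun j _ => ?_
    rw [← Finset.sum_erase (s := Finset.univ) (a := j) (f := T j) (by simp [hT])]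
    refine Finset.sum_congr rfl fun k hk => ?_
    simp [hT, Finset.ne_of_mem_erase hk]
  have h2 : ∑ j, ∑ k, T j k = - ∑ j, ∑ k, T j k := by
    conv_lhs => rw [Finset.sum_comm]
    simp_rw [← Finset.sum_neg_distrib]
    exact Finset.sum_congr rfl fun j _ => Finset.sum_congr rfl fun k _ => hT' _ _
  rw [h1]; linarith

theorem ContDiff.continuous_det_fderiv {f : E → E} (hf : ContDiff ℝ 2 f) :
    Continuous fun x => (fderiv ℝ f x).det :=
  ContinuousLinearMap.continuous_det.comp (hf.continuous_fderiv two_ne_zero)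

theorem exists_pos_forall_mul_le_dist {α : Type*} [PseudoMetricSpace α] {s t : Set α} (hs : IsCompact s) (ht : IsClosed t)
    (hst : Disjoint s t) {C : ℝ} (hC : 0 < C) :
    ∃ ρ > 0, ∀ x ∈ s, ∀ y ∈ t, C * ρ ≤ dist x y := by
  obtain ⟨r, hr, h⟩ := Metric.exists_pos_forall_lt_edist hs ht hst
  refine ⟨r / C, div_pos (by exact_mod_cast hr) hC, fun x hx y hy => ?_⟩
  rw [mul_div_cancel₀ _ hC.ne']
  have := h x hx y hy
  rw [edist_nndist] at this
  exact_mod_cast this.le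

theorem isPreconnected_compl_closedBall (h : 1 < Module.rank ℝ E) {R : ℝ} (hR : 0 ≤ R) :
    IsPreconnected (closedBall (0 : E) R)ᶜ := by
  have h1 : (closedBall (0 : E) R)ᶜ = (fun x : E => (1 + R / ‖x‖) • x) '' {0}ᶜ := by
    ext y
    simp only [mem_compl_iff, mem_closedBall_zero_iff, not_le, mem_image, mem_singleton_iff]
    constructor
    · intro hy
      have hy0 : 0 < ‖y‖ := hR.trans_lt hy
      have hpos : 0 < 1 - R / ‖y‖ := by rw [sub_pos, div_lt_one hy0]; exact hy
      refine ⟨(1 - R / ‖y‖) • y, smul_ne_zero hpos.ne' (norm_pos_iff.1 hy0), ?_⟩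
      have hne : ‖y‖ - R ≠ 0 := (sub_pos.2 hy).ne'
      rw [norm_smul, Real.norm_of_nonneg hpos.le, smul_smul]
      have : (1 + R / ((1 - R / ‖y‖) * ‖y‖)) * (1 - R / ‖y‖) = 1 := by
        rw [sub_mul, div_mul_cancel₀ _ hy0.ne', one_mul]
        field_simp
        ring
      rw [this, one_smul]
    · rintro ⟨x, hx, rfl⟩
      have hx0 : 0 < ‖x‖ := norm_pos_iff.2 hx
      rw [norm_smul, Real.norm_of_nonneg (by positivity), add_mul, div_mul_cancel₀ _ hx0.ne']
      linarith
  rw [h1]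
  refine (isConnected_compl_singleton_of_one_lt_rank h 0).isPreconnected.image _ ?_
  exact (continuousOn_const.add (continuousOn_const.div continuous_norm.continuousOn
    fun x hx => norm_ne_zero_iff.2 hx)).smul continuousOn_id

theorem frontier_connectedComponentIn_subset {α : Type*} [TopologicalSpace α]
    [LocallyConnectedSpace α] {O : Set α} (hO : IsOpen O) (x : α) :
    frontier (connectedComponentIn O x) ⊆ Oᶜ := by
  intro y hy hyO
  rw [hO.connectedComponentIn.frontier_eq] at hy
  obtain ⟨z, hz, hzx⟩ := mem_closure_iff.1 hy.1 _ hO.connectedComponentIn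
    (mem_connectedComponentIn hyO)
  refine hy.2 ?_
  rw [connectedComponentIn_eq hzx, ← connectedComponentIn_eq hz]
  exact mem_connectedComponentIn hyO

section Defs

variable [MeasurableSpace E]

variable (μ : Measure E)

/-- The integral over `U` of the pullback under `f` of the top degree form `φ μ`. -/
noncomputable def jacobianIntegral (f : E → E) (U : Set E) (φ : E → ℝ) : ℝ :=
  ∫ x in U, φ (f x) * (fderiv ℝ f x).det ∂μ

/-- `c` is the degree over `closedBall y ρ` of every smooth map which is `ρ`-close to `f`
on `frontier U`. -/
def HasDegreeWith (f : E → E) (U : Set E) (y : E) (ρ c : ℝ) : Prop :=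
  ∀ g : E → E, ContDiff ℝ 2 g → (∀ x ∈ frontier U, dist (g x) (f x) ≤ ρ) →
    ∀ φ : E → ℝ, ContDiff ℝ 1 φ → tsupport φ ⊆ closedBall y ρ →
      jacobianIntegral μ g U φ = c * ∫ z, φ z ∂μ

/-- `c` is the degree of `f : U → E` at `y`. -/
def HasDegree (f : E → E) (U : Set E) (y : E) (c : ℝ) : Prop :=
  ∃ ρ > 0, HasDegreeWith μ f U y ρ c

variable {μ}

theorem HasDegreeWith.mono {f : E → E} {U : Set E} {y y' : E} {ρ ρ' c : ℝ}
    (h : HasDegreeWith μ f U y ρ c) (hρ : ρ' + dist y' y ≤ ρ) : HasDegreeWith μ f U y' ρ' c := by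
  intro g hg hgf φ hφ hφy
  refine h g hg (fun x hx => (hgf x hx).trans ?_) φ hφ
    (hφy.trans (closedBall_subset_closedBall' hρ))
  linarith [dist_nonneg (x := y') (y := y)]

theorem HasDegree.eventually {f : E → E} {U : Set E} {y : E} {c : ℝ} (h : HasDegree μ f U y c) :
    ∀ᶠ y' in 𝓝 y, HasDegree μ f U y' c := by
  obtain ⟨ρ, hρ, h⟩ := h
  filter_upwards [ball_mem_nhds y (half_pos hρ)] with y' hy'
  exact ⟨ρ / 2, half_pos hρ, h.mono (by rw [mem_ball] at hy'; linarith)⟩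

theorem HasDegree.congr {f g : E → E} {U : Set E} {y : E} {c : ℝ} (h : HasDegree μ f U y c)
    (hfg : EqOn f g (frontier U)) : HasDegree μ g U y c := by
  obtain ⟨ρ, hρ, h⟩ := h
  exact ⟨ρ, hρ, fun k hk hkg => h k hk fun x hx => by rw [hfg hx]; exact hkg x hx⟩

open Classical in
/-- The degree of `f : U → E` at `y`, or zero if it does not exist. -/
noncomputable def degree (μ : Measure E) (f : E → E) (U : Set E) (y : E) : ℝ :=
  if h : ∃ c, HasDegree μ f U y c then h.choose else 0

end Defs

variable [FiniteDimensional ℝ E]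

theorem exists_contDiff_dist_le {f : E → E} (hf : Continuous f) {ρ : ℝ} (hρ : 0 < ρ) :
    ∃ g : E → E, ContDiff ℝ 2 g ∧ ∀ x, dist (g x) (f x) ≤ ρ := by
  obtain ⟨g, h1, h2, -⟩ := hf.exists_contDiff_approx 2 continuous_const (fun _ => hρ)
  exact ⟨g, h1, fun x => (h2 x).le⟩

theorem exists_extension_norm_le {A : Set E} (hA : IsClosed A) {R : ℝ} (hR : 0 < R) (f : C(A, E))
    (hf : ∀ x, ‖f x‖ ≤ R) :
    ∃ F : E → E, Continuous F ∧ (∀ x, ‖F x‖ ≤ R) ∧ ∀ x : A, F x = f x := by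
  have := Metric.instTietzeExtensionClosedBall ℝ (0 : E) hR
  obtain ⟨F, hF, hFf⟩ := f.exists_forall_mem_restrict_eq hA (t := closedBall 0 R)
    fun x => mem_closedBall_zero_iff.2 (hf x)
  exact ⟨F, F.continuous, fun x => mem_closedBall_zero_iff.1 (hF x), fun x => DFunLike.congr_fun hFf x⟩

/-- The determinant with respect to a basis, as a continuous multilinear map. -/
noncomputable def Module.Basis.detCMM (b : Basis ι ℝ E) :
    ContinuousMultilinearMap ℝ (fun _ : ι => E) ℝ where
  toMultilinearMap := b.det.toMultilinearMap
  cont := by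
    change Continuous fun v : ι → E => (b.toMatrix v).det
    refine Continuous.matrix_det (continuous_matrix fun i j => ?_)
    exact (LinearMap.continuous_of_finiteDimensional (b.coord i)).comp (continuous_apply j)

theorem Module.Basis.detCMM_clm_apply (b : Basis ι ℝ E) (A : E →L[ℝ] E) :
    b.detCMM (fun k => A (b k)) = A.det := by
  have := b.det_comp (A : E →ₗ[ℝ] E) b
  rw [b.det_self, mul_one] at this
  exact this

/-- The components, in the basis `b`, of the vector field `φ(f) • adj(Df) h`. -/
noncomputable def cofactorField (b : Basis ι ℝ E) (φ : E → ℝ) (f h : E → E) (j : ι) (x : E) : ℝ :=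
  φ (f x) * b.detCMM (Function.update (fun k => fderiv ℝ f x (b k)) j (h x))

/-- The divergence of `φ(f) • adj(Df) h`. -/
noncomputable def cofactorDiv (b : Basis ι ℝ E) (φ : E → ℝ) (f h : E → E) (x : E) : ℝ :=
  fderiv ℝ φ (f x) (h x) * b.detCMM (fun k => fderiv ℝ f x (b k)) +
    φ (f x) * ∑ j, b.detCMM
      (Function.update (fun k => fderiv ℝ f x (b k)) j (fderiv ℝ h x (b j)))

theorem contDiff_cofactorField (b : Basis ι ℝ E) {φ : E → ℝ} {f h : E → E}
    (hφ : ContDiff ℝ 1 φ) (hf : ContDiff ℝ 2 f) (hh : ContDiff ℝ 2 h) (j : ι) :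
    ContDiff ℝ 1 (cofactorField b φ f h j) := by
  refine (hφ.comp (hf.of_le one_le_two)).mul (b.detCMM.contDiff.comp ?_)
  refine contDiff_pi.2 fun k => ?_
  by_cases hk : k = j
  · subst hk; simpa using hh.of_le one_le_two
  · simpa [hk] using (hf.fderiv_right (m := 1) le_rfl).clm_apply contDiff_const

/-- **Piola's identity.** -/
theorem sum_fderiv_cofactorField (b : Basis ι ℝ E) {φ : E → ℝ} {f h : E → E}
    (hφ : ContDiff ℝ 1 φ) (hf : ContDiff ℝ 2 f) (hh : ContDiff ℝ 2 h) (x : E) :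
    ∑ j, fderiv ℝ (cofactorField b φ f h j) x (b j) = cofactorDiv b φ f h x := by
  set w : ι → E := fun k => fderiv ℝ f x (b k) with hw
  have hφ' : HasFDerivAt (fun y => φ (f y)) ((fderiv ℝ φ (f x)).comp (fderiv ℝ f x)) x :=
    ((hφ.differentiable one_ne_zero) _).hasFDerivAt.comp x
      ((hf.differentiable two_ne_zero) x).hasFDerivAt
  have hf1 : ContDiff ℝ 1 (fderiv ℝ f) := hf.fderiv_right (m := 1) le_rfl
  set D2 : E →L[ℝ] E →L[ℝ] E := fderiv ℝ (fderiv ℝ f) x with hD2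
  have hD : ∀ k, HasFDerivAt (fun y => fderiv ℝ f y (b k)) (D2.flip (b k)) x := by
    intro k
    have := ((hf1.differentiable one_ne_zero) x).hasFDerivAt.clm_apply (hasFDerivAt_const (b k) x)
    convert this using 1
    ext v; simp [hD2]
  have hsymm : ∀ u v, D2 u v = D2 v u := fun u v =>
    second_derivative_symmetric (f := f) (f' := fderiv ℝ f)
      (fun y => ((hf.differentiable two_ne_zero) y).hasFDerivAt)
      ((hf1.differentiable one_ne_zero) x).hasFDerivAt u v
  have hh' : HasFDerivAt h (fderiv ℝ h x) x := ((hh.differentiable two_ne_zero) x).hasFDerivAt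
  have hterm : ∀ j, fderiv ℝ (cofactorField b φ f h j) x (b j) =
      b.det (Function.update w j (h x)) * (fderiv ℝ φ (f x)) (w j) +
      φ (f x) * b.det (Function.update w j (fderiv ℝ h x (b j))) +
      φ (f x) * ∑ k ∈ Finset.univ.erase j,
        b.det (Function.update (Function.update w j (h x)) k (D2 (b j) (b k))) := by
    intro j
    have hcol : ∀ k, HasFDerivAt
        (fun y => Function.update (fun k => fderiv ℝ f y (b k)) j (h y) k)
        (if k = j then fderiv ℝ h x else D2.flip (b k)) x := by
      intro k
      by_cases hk : k = j
      · subst hk; simpa using hh'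
      · simpa [hk] using hD k
    have := (hφ'.mul (HasFDerivAt.multilinear_comp (f := b.detCMM) hcol)).fderiv
    change fderiv ℝ (cofactorField b φ f h j) x = _ at this
    rw [this]
    simp only [add_apply, smul_apply, smul_eq_mul, sum_apply, ContinuousLinearMap.comp_apply]
    rw [← Finset.add_sum_erase _ _ (Finset.mem_univ j)]
    have e1 : ∀ k ∈ Finset.univ.erase j, (b.detCMM.toContinuousLinearMap
        (fun i => Function.update w j (h x) i) k)
          ((if k = j then fderiv ℝ h x else D2.flip (b k)) (b j)) =
        b.det (Function.update (Function.update w j (h x)) k (D2 (b j) (b k))) := by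
      intro k hk
      simp only [Finset.ne_of_mem_erase hk, if_false]
      rfl
    rw [Finset.sum_congr rfl e1]
    have e2 : (b.detCMM.toContinuousLinearMap (fun i => Function.update w j (h x) i) j)
        ((if j = j then fderiv ℝ h x else D2.flip (b j)) (b j)) =
        b.det (Function.update w j (fderiv ℝ h x (b j))) := by
      simp only [if_true]
      change b.det (Function.update (Function.update w j (h x)) j _) = _
      rw [Function.update_idem]
    rw [e2]
    change _ + b.det (Function.update w j (h x)) * _ = _
    ring
  simp only [hterm, Finset.sum_add_distrib, ← Finset.mul_sum]
  rw [b.sum_det_update_update_eq_zero w (h x) (fun j k => D2 (b j) (b k))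
    (fun _ _ => hsymm _ _), mul_zero, add_zero]
  have := b.sum_det_update_mul w (h x) (fderiv ℝ φ (f x) : E →ₗ[ℝ] ℝ)
  simp only [ContinuousLinearMap.coe_coe] at this
  rw [this, mul_comm]
  rfl

section Haar

variable [MeasurableSpace E] [BorelSpace E] (μ : Measure E) [μ.IsAddHaarMeasure]

theorem setIntegral_fderiv_eq_zero {U : Set E} (hU : IsOpen U) (hb : Bornology.IsBounded U)
    {v : E → ℝ} (hv : ContDiff ℝ 1 v) {O : Set E} (hO : IsOpen O) (hUO : frontier U ⊆ O)
    (hvO : ∀ x ∈ O, v x = 0) (e : E) : ∫ x in U, fderiv ℝ v x e ∂μ = 0 := by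
  have hin : ∀ x ∈ U, U.indicator v =ᶠ[𝓝 x] v := fun x hx => by
    filter_upwards [hU.mem_nhds hx] with y hy using indicator_of_mem hy v
  have hout : ∀ x ∉ U, U.indicator v =ᶠ[𝓝 x] fun _ => 0 := fun x hx => by
    by_cases hxc : x ∈ closure U
    · have hxf : x ∈ frontier U := by rw [hU.frontier_eq]; exact ⟨hxc, hx⟩
      filter_upwards [hO.mem_nhds (hUO hxf)] with y hy
      by_cases hyU : y ∈ U
      · rw [indicator_of_mem hyU, hvO y hy]
      · exact indicator_of_notMem hyU v
    · filter_upwards [isClosed_closure.isOpen_compl.mem_nhds hxc] with y hy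
      exact indicator_of_notMem (fun h => hy (subset_closure h)) v
  have hsm : ContDiff ℝ 1 (U.indicator v) := contDiff_iff_contDiffAt.2 fun x => by
    by_cases hx : x ∈ U
    · exact hv.contDiffAt.congr_of_eventuallyEq (hin x hx)
    · exact contDiffAt_const.congr_of_eventuallyEq (hout x hx)
  have hcs : HasCompactSupport (U.indicator v) :=
    HasCompactSupport.intro (hb.closure.isCompact_closure) fun x hx =>
      indicator_of_notMem (fun h => hx (subset_closure (subset_closure h))) v
  have hd : ∀ x, U.indicator (fun x => fderiv ℝ v x e) x = fderiv ℝ (U.indicator v) x e := by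
    intro x
    by_cases hx : x ∈ U
    · rw [indicator_of_mem hx, (hin x hx).fderiv_eq]
    · rw [indicator_of_notMem hx, (hout x hx).fderiv_eq]; simp
  rw [← integral_indicator hU.measurableSet]
  simp only [hd]
  have h_integrable : Integrable (fun x => fderiv ℝ (U.indicator v) x e) μ :=
    ((hsm.continuous_fderiv one_ne_zero).clm_apply continuous_const).integrable_of_hasCompactSupport
      (hcs.fderiv_apply ℝ e)
  have := integral_mul_fderiv_eq_neg_fderiv_mul_of_integrable (μ := μ) (f := fun _ : E => (1 : ℝ))
    (g := U.indicator v) (v := e) (by simp) (by simpa using h_integrable)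
    (by simpa using hsm.continuous.integrable_of_hasCompactSupport hcs)
    (fun x _ => differentiableAt_const _) (fun x _ => hsm.differentiable one_ne_zero x)
  simpa using this

theorem jacobianIntegral_eq_of_homotopy {U : Set E} (hU : IsOpen U) (hb : Bornology.IsBounded U)
    {f g : E → E} (hf : ContDiff ℝ 2 f) (hg : ContDiff ℝ 2 g) {φ : E → ℝ} (hφ : ContDiff ℝ 1 φ)
    (h : ∀ x ∈ frontier U, ∀ t ∈ Icc (0 : ℝ) 1, f x + t • (g x - f x) ∉ tsupport φ) :
    jacobianIntegral μ f U φ = jacobianIntegral μ g U φ := by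
  set b := Module.finBasis ℝ E
  set k : E → E := fun x => g x - f x with hk
  have hkd : ContDiff ℝ 2 k := hg.sub hf
  set F : ℝ → E → E := fun t x => f x + t • k x with hF
  have hFd : ∀ t, ContDiff ℝ 2 (F t) := fun t => hf.add (hkd.const_smul t)
  have hFf : ∀ t x, fderiv ℝ (F t) x = fderiv ℝ f x + t • fderiv ℝ k x := fun t x => by
    have := ((hf.differentiable two_ne_zero x).hasFDerivAt.add
      ((hkd.differentiable two_ne_zero x).hasFDerivAt.const_smul t)).fderiv
    exact this
  set G : ℝ → E → ℝ := fun t x => φ (F t x) * (fderiv ℝ (F t) x).det with hG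
  have hderiv : ∀ x t, HasDerivAt (fun s => G s x) (cofactorDiv b φ (F t) k x) t := by
    intro x t
    have h1 : HasDerivAt (fun s => F s x) (k x) t := by
      simpa [hF] using! ((hasDerivAt_id t).smul_const (k x)).const_add (f x)
    have h2 : HasDerivAt (fun s => φ (F s x)) (fderiv ℝ φ (F t x) (k x)) t :=
      ((hφ.differentiable one_ne_zero _).hasFDerivAt).comp_hasDerivAt t h1
    have h3 : ∀ j, HasFDerivAt (fun s : ℝ => fderiv ℝ (F s) x (b j))
        (ContinuousLinearMap.toSpanSingleton ℝ (fderiv ℝ k x (b j))) t := by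
      intro j
      have : HasDerivAt (fun s : ℝ => fderiv ℝ (F s) x (b j)) (fderiv ℝ k x (b j)) t := by
        simp only [hFf]
        simpa using ((hasDerivAt_id t).smul_const (fderiv ℝ k x (b j))).const_add
          (fderiv ℝ f x (b j))
      exact this.hasFDerivAt
    have h4 := (HasFDerivAt.multilinear_comp (f := b.detCMM) h3).hasDerivAt
    have h5 := h2.mul h4
    simp only [hG, ← b.detCMM_clm_apply]
    refine h5.congr_deriv ?_
    simp [cofactorDiv]
  have hcont : Continuous fun p : ℝ × E => cofactorDiv b φ (F p.1) k p.2 := by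
    have c1 : Continuous fun p : ℝ × E => F p.1 p.2 := by
      have := hf.continuous; have := hkd.continuous
      simp only [hF]; fun_prop
    have c2 : ∀ j, Continuous fun p : ℝ × E => fderiv ℝ (F p.1) p.2 (b j) := by
      intro j
      simp only [hFf]
      have a1 := (hf.continuous_fderiv two_ne_zero)
      have a2 := (hkd.continuous_fderiv two_ne_zero)
      fun_prop
    have c3 : ∀ j, Continuous fun x : E => fderiv ℝ k x (b j) := fun j =>
      (hkd.continuous_fderiv two_ne_zero).clm_apply continuous_const
    have c4 : Continuous fun p : ℝ × E => fderiv ℝ φ (F p.1 p.2) (k p.2) :=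
      ((hφ.continuous_fderiv one_ne_zero).comp c1).clm_apply (hkd.continuous.comp continuous_snd)
    refine (c4.mul (b.detCMM.cont.comp (continuous_pi c2))).add
      ((hφ.continuous.comp c1).mul (continuous_finsetSum _ fun j _ => b.detCMM.cont.comp ?_))
    exact (continuous_pi c2).update j ((c3 j).comp continuous_snd)
  have hzero : ∀ t ∈ Icc (0 : ℝ) 1, ∫ x in U, cofactorDiv b φ (F t) k x ∂μ = 0 := by
    intro t ht
    simp only [← sum_fderiv_cofactorField b hφ (hFd t) hkd]
    have hz : ∀ j, ∫ x in U, fderiv ℝ (cofactorField b φ (F t) k j) x (b j) ∂μ = 0 := fun j => by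
      refine setIntegral_fderiv_eq_zero μ hU hb
        (contDiff_cofactorField b hφ (hFd t) hkd j) (O := {x | F t x ∉ tsupport φ})
        ((isClosed_tsupport φ).isOpen_compl.preimage (hFd t).continuous)
        (fun x hx => h x hx t ht) (fun x hx => ?_) _
      simp [cofactorField, image_eq_zero_of_notMem_tsupport hx]
    rw [integral_finsetSum]
    · simp [hz]
    · intro j _
      have hc : Continuous fun x => fderiv ℝ (cofactorField b φ (F t) k j) x (b j) :=
        ((contDiff_cofactorField b hφ (hFd t) hkd j).continuous_fderiv one_ne_zero).clm_apply
          continuous_const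
      exact (hc.continuousOn.integrableOn_compact hb.isCompact_closure).mono_set subset_closure
  have hGi : ∀ t, IntegrableOn (G t) U μ := fun t =>
    (((hφ.continuous.comp (hFd t).continuous).mul
      (hFd t).continuous_det_fderiv).continuousOn.integrableOn_compact
        hb.isCompact_closure).mono_set subset_closure
  have h_integrable : Integrable (Function.uncurry fun t x => cofactorDiv b φ (F t) k x)
      ((volume.restrict (uIoc (0 : ℝ) 1)).prod (μ.restrict U)) := by
    rw [Measure.prod_restrict]
    refine (hcont.continuousOn.integrableOn_compact
      ((isCompact_Icc (a := (0 : ℝ)) (b := 1)).prod hb.isCompact_closure)).mono_set ?_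
    rw [uIoc_of_le zero_le_one]
    exact prod_mono Ioc_subset_Icc_self subset_closure
  have hswap := intervalIntegral_integral_swap h_integrable
  rw [intervalIntegral.integral_congr (g := fun _ => (0 : ℝ))
    (fun t ht => hzero t (by rwa [uIcc_of_le zero_le_one] at ht))] at hswap
  have hftc : ∀ x, ∫ t in (0 : ℝ)..1, cofactorDiv b φ (F t) k x = G 1 x - G 0 x := fun x =>
    intervalIntegral.integral_eq_sub_of_hasDerivAt (fun t _ => hderiv x t)
      ((hcont.comp (Continuous.prodMk_left x)).intervalIntegrable _ _)
  simp only [hftc] at hswap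
  rw [integral_sub (hGi 1) (hGi 0)] at hswap
  have hF0 : F 0 = f := by ext1 x; simp [hF]
  have hF1 : F 1 = g := by ext1 x; simp [hF, hk]
  simp only [hG, hF0, hF1, intervalIntegral.integral_zero] at hswap
  simp only [jacobianIntegral]
  linarith

theorem jacobianIntegral_comp_sub {U : Set E} (hU : IsOpen U) (hb : Bornology.IsBounded U)
    {f : E → E} (hf : ContDiff ℝ 2 f) {φ : E → ℝ} (hφ : ContDiff ℝ 1 φ) {z : E}
    (h : ∀ x ∈ frontier U, ∀ u ∈ tsupport φ, ‖z‖ < dist (f x) u) :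
    jacobianIntegral μ f U (fun u => φ (u - z)) = jacobianIntegral μ f U φ := by
  rw [jacobianIntegral_eq_of_homotopy μ hU hb hf (hf.sub (contDiff_const (c := z))) hφ]
  · simp [jacobianIntegral, fderiv_sub_const]
  · intro x hx t ht hmem
    have := h x hx _ hmem
    rw [dist_eq_norm] at this
    have e : f x - (f x + t • (f x - z - f x)) = t • z := by
      rw [show f x - z - f x = -z by abel, smul_neg]; abel
    rw [e, norm_smul, Real.norm_of_nonneg ht.1] at this
    nlinarith [norm_nonneg z, ht.2]

/-- Fubini's theorem for a jacobian integral of a convolution. -/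
theorem integral_mul_jacobianIntegral_swap {U : Set E} (hb : Bornology.IsBounded U)
    {f : E → E} (hf : ContDiff ℝ 2 f) {φ ψ : E → ℝ} (hφ : Continuous φ) (hψ : Continuous ψ)
    (hφc : HasCompactSupport φ) (hψc : HasCompactSupport ψ) :
    ∫ z, φ z * jacobianIntegral μ f U (fun u => ψ (u - z)) ∂μ =
      ∫ z, ψ z * jacobianIntegral μ f U (fun u => φ (u - z)) ∂μ := by
  have key : ∀ {φ ψ : E → ℝ}, Continuous φ → Continuous ψ → HasCompactSupport φ →
      HasCompactSupport ψ → ∫ z, φ z * jacobianIntegral μ f U (fun u => ψ (u - z)) ∂μ =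
      ∫ x in U, (∫ z, φ z * ψ (f x - z) ∂μ) * (fderiv ℝ f x).det ∂μ := by
    intro φ ψ hφ hψ hφc hψc
    simp only [jacobianIntegral, ← integral_const_mul, ← integral_mul_const]
    rw [integral_integral_swap]
    · simp only [mul_assoc]
    · have h1 : Integrable φ μ := hφ.integrable_of_hasCompactSupport hφc
      have h2 : Integrable (fun x => (fderiv ℝ f x).det) (μ.restrict U) :=
        (hf.continuous_det_fderiv.continuousOn.integrableOn_compact
          hb.isCompact_closure).mono_set subset_closure
      obtain ⟨C, hC⟩ := hψ.bounded_above_of_compact_support hψc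
      have hc : Continuous fun p : E × E => ψ (f p.2 - p.1) := by
        have := hf.continuous
        fun_prop
      have := (h1.mul_prod h2).bdd_mul (c := C) hc.aestronglyMeasurable
        (Eventually.of_forall fun p => hC _)
      refine this.congr (Eventually.of_forall fun p => ?_)
      simp only [Function.uncurry]
      ring
  rw [key hφ hψ hφc hψc, key hψ hφ hψc hφc]
  congr 1
  ext1 x
  congr 1
  rw [← integral_sub_left_eq_self _ μ (f x)]
  simp [mul_comm]

theorem jacobianIntegral_eq_integral_mul {U : Set E} (hU : IsOpen U) (hb : Bornology.IsBounded U)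
    {f : E → E} (hf : ContDiff ℝ 2 f) {φ : E → ℝ} (hφ : ContDiff ℝ 1 φ)
    (hφc : HasCompactSupport φ) (η : ContDiffBump (0 : E))
    (h : ∀ x ∈ frontier U, ∀ u ∈ tsupport φ, η.rOut < dist (f x) u) :
    jacobianIntegral μ f U φ =
      ∫ z, φ z * jacobianIntegral μ f U (fun u => η.normed μ (u - z)) ∂μ := by
  rw [integral_mul_jacobianIntegral_swap μ hb hf hφ.continuous η.continuous_normed hφc
    η.hasCompactSupport_normed]
  have : ∀ z, η.normed μ z * jacobianIntegral μ f U (fun u => φ (u - z)) =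
      η.normed μ z * jacobianIntegral μ f U φ := fun z => by
    by_cases hz : z ∈ ball (0 : E) η.rOut
    · rw [jacobianIntegral_comp_sub μ hU hb hf hφ]
      exact fun x hx u hu => (mem_ball_zero_iff.1 hz).trans (h x hx u hu)
    · rw [← η.support_normed_eq (μ := μ), Function.notMem_support] at hz
      simp [hz]
  simp only [this, integral_mul_const, η.integral_normed, one_mul]

theorem jacobianIntegral_eq_mul_integral {U : Set E} (hU : IsOpen U) (hb : Bornology.IsBounded U)
    {f : E → E} (hf : ContDiff ℝ 2 f) {φ : E → ℝ} (hφ : ContDiff ℝ 1 φ) (η : ContDiffBump (0 : E))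
    {y : E} {ρ : ℝ} (hφy : tsupport φ ⊆ closedBall y ρ)
    (h : ∀ x ∈ frontier U, η.rOut + ρ < dist (f x) y) :
    jacobianIntegral μ f U φ =
      jacobianIntegral μ f U (fun u => η.normed μ (u - y)) * ∫ z, φ z ∂μ := by
  have hφc : HasCompactSupport φ := (isCompact_closedBall y ρ).of_isClosed_subset
    (isClosed_tsupport φ) hφy
  rw [jacobianIntegral_eq_integral_mul μ hU hb hf hφ hφc η, ← integral_const_mul]
  · congr 1
    ext1 z
    by_cases hz : z ∈ tsupport φ
    · have h1 : (fun u => η.normed μ (u - z)) =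
          fun u => (fun u => η.normed μ (u - y)) (u - (z - y)) := by
        ext1 u; congr 1; abel
      have h2 : ContDiff ℝ 1 fun u => η.normed μ (u - y) :=
        (η.contDiff_normed (n := 1)).comp (contDiff_id.sub contDiff_const)
      rw [mul_comm, h1, jacobianIntegral_comp_sub μ hU hb hf h2]
      intro x hx u hu
      have hu' : u - y ∈ tsupport (η.normed μ) := by
        exact (tsupport_comp_subset_preimage (η.normed μ) (f := fun u : E => u - y) (by fun_prop)) hu
      rw [η.tsupport_normed_eq, mem_closedBall_zero_iff, ← dist_eq_norm] at hu'
      have h2 := hφy hz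
      rw [mem_closedBall, dist_eq_norm] at h2
      linarith [h x hx, dist_triangle (f x) u y]
    · simp [image_eq_zero_of_notMem_tsupport hz]
  · intro x hx u hu
    linarith [h x hx, dist_triangle (f x) u y, mem_closedBall.1 (hφy hu)]

theorem exists_hasDegreeWith {f : E → E} (hf : Continuous f) {U : Set E} (hU : IsOpen U)
    (hb : Bornology.IsBounded U) {y : E} {ρ : ℝ} (hρ : 0 < ρ)
    (h : ∀ x ∈ frontier U, 4 * ρ ≤ dist (f x) y) : ∃ c, HasDegreeWith μ f U y ρ c := by
  obtain ⟨k, hk, hkf⟩ := exists_contDiff_dist_le hf hρ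
  let η : ContDiffBump (0 : E) := ⟨ρ / 2, ρ, half_pos hρ, half_lt_self hρ⟩
  refine ⟨jacobianIntegral μ k U (fun u => η.normed μ (u - y)), fun g hg hgf φ hφ hφy => ?_⟩
  have h3 : ∀ x ∈ frontier U, η.rOut + ρ < dist (k x) y := fun x hx => by
    have : η.rOut = ρ := rfl
    linarith [h x hx, dist_triangle (f x) (k x) y, hkf x, dist_comm (f x) (k x)]
  rw [← jacobianIntegral_eq_mul_integral μ hU hb hk hφ η hφy h3]
  refine jacobianIntegral_eq_of_homotopy μ hU hb hg hk hφ fun x hx t ht hmem => ?_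
  have h4 : g x + t • (k x - g x) ∈ closedBall (f x) ρ := by
    have := (convex_closedBall (f x) ρ).add_smul_sub_mem (mem_closedBall.2 (hgf x hx))
      (mem_closedBall.2 (hkf x)) ht
    exact this
  have h5 := hφy hmem
  rw [mem_closedBall] at h4 h5
  rw [dist_comm] at h4
  linarith [h x hx, dist_triangle (f x) (g x + t • (k x - g x)) y]

variable {μ}

theorem HasDegree.unique {f : E → E} (hf : Continuous f) {U : Set E} {y : E} {c c' : ℝ}
    (h : HasDegree μ f U y c) (h' : HasDegree μ f U y c') : c = c' := by
  obtain ⟨ρ, hρ, h⟩ := h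
  obtain ⟨ρ', hρ', h'⟩ := h'
  have hm : 0 < min ρ ρ' := lt_min hρ hρ'
  obtain ⟨k, hk, hkf⟩ := exists_contDiff_dist_le hf hm
  let η : ContDiffBump y := ⟨min ρ ρ' / 2, min ρ ρ', half_pos hm, half_lt_self hm⟩
  have h1 := h.mono (y' := y) (ρ' := min ρ ρ') (by simp) k hk (fun x _ => hkf x) (η.normed μ)
    η.contDiff_normed (η.tsupport_normed_eq (μ := μ)).subset
  have h2 := h'.mono (y' := y) (ρ' := min ρ ρ') (by simp) k hk (fun x _ => hkf x) (η.normed μ)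
    η.contDiff_normed (η.tsupport_normed_eq (μ := μ)).subset
  rw [η.integral_normed, mul_one] at h1 h2
  rw [← h1, h2]

theorem exists_hasDegree {f : E → E} (hf : Continuous f) {U : Set E} (hU : IsOpen U)
    (hb : Bornology.IsBounded U) {y : E} (hy : y ∉ f '' frontier U) :
    ∃ ρ > 0, (∀ x ∈ frontier U, 4 * ρ ≤ dist (f x) y) ∧ ∃ c, HasDegreeWith μ f U y ρ c := by
  have hc : IsCompact (f '' frontier U) :=
    (hb.isCompact_closure.of_isClosed_subset isClosed_frontier frontier_subset_closure).image hf
  obtain ⟨ε, hε, h⟩ := Metric.isOpen_iff.1 hc.isClosed.isOpen_compl y hy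
  have h4 : ∀ x ∈ frontier U, 4 * (ε / 4) ≤ dist (f x) y := fun x hx => by
    by_contra! hlt
    exact h (by rw [mem_ball]; linarith) (mem_image_of_mem f hx)
  exact ⟨ε / 4, by positivity, h4, exists_hasDegreeWith μ hf hU hb (by positivity) h4⟩

theorem HasDegree.degree_eq {f : E → E} (hf : Continuous f) {U : Set E} {y : E} {c : ℝ}
    (h : HasDegree μ f U y c) : degree μ f U y = c := by
  have hex : ∃ c, HasDegree μ f U y c := ⟨c, h⟩
  rw [degree, dif_pos hex]
  exact hex.choose_spec.unique hf h

theorem hasDegree_degree {f : E → E} (hf : Continuous f) {U : Set E} (hU : IsOpen U)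
    (hb : Bornology.IsBounded U) {y : E} (hy : y ∉ f '' frontier U) :
    HasDegree μ f U y (degree μ f U y) := by
  obtain ⟨ρ, hρ, -, c, hc⟩ := exists_hasDegree (μ := μ) hf hU hb hy
  have : HasDegree μ f U y c := ⟨ρ, hρ, hc⟩
  rwa [this.degree_eq hf]

theorem hasDegree_zero {f : E → E} (hf : Continuous f) {U : Set E} (hU : IsOpen U)
    (hb : Bornology.IsBounded U) {y : E} (hy : y ∉ f '' closure U) : HasDegree μ f U y 0 := by
  obtain ⟨ε, hε, h⟩ := Metric.isOpen_iff.1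
    (hb.isCompact_closure.image hf).isClosed.isOpen_compl y hy
  have hy' : y ∉ f '' frontier U := fun h => hy (image_mono frontier_subset_closure h)
  obtain ⟨ρ, hρ, -, c, hc⟩ := exists_hasDegree (μ := μ) hf hU hb hy'
  set r := min ρ (ε / 4)
  have hr : 0 < r := by positivity
  obtain ⟨k, hk, hkf⟩ := exists_contDiff_dist_le hf hr
  let η : ContDiffBump y := ⟨r / 2, r, half_pos hr, half_lt_self hr⟩
  have h1 := hc.mono (y' := y) (ρ' := r) (by simp [r]) k hk (fun x _ => hkf x) (η.normed μ)
    η.contDiff_normed (η.tsupport_normed_eq (μ := μ)).subset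
  have h2 : jacobianIntegral μ k U (η.normed μ) = 0 := by
    rw [jacobianIntegral, setIntegral_eq_zero_of_forall_eq_zero]
    intro x hx
    have : k x ∉ Function.support (η.normed μ) := fun hm => by
      rw [η.support_normed_eq, mem_ball] at hm
      have h3 : r ≤ ε / 4 := min_le_right _ _
      have h4 : dist (k x) y < r := hm
      refine h (a := f x) ?_ (mem_image_of_mem f (subset_closure hx))
      rw [mem_ball]
      linarith [hkf x, dist_triangle (f x) (k x) y, dist_comm (f x) (k x)]
    rw [Function.notMem_support.1 this, zero_mul]
  rw [h2, η.integral_normed, mul_one] at h1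
  exact ⟨ρ, hρ, h1 ▸ hc⟩

theorem hasDegree_id {U : Set E} (hU : IsOpen U) (hb : Bornology.IsBounded U) {y : E}
    (hy : y ∈ U) : HasDegree μ id U y 1 := by
  obtain ⟨ε, hε, h⟩ := Metric.isOpen_iff.1 hU y hy
  obtain ⟨ρ, hρ, -, c, hc⟩ := exists_hasDegree (μ := μ) continuous_id hU hb (y := y)
    (by rw [image_id, hU.frontier_eq]; exact fun h => h.2 hy)
  set r := min ρ ε
  have hr : 0 < r := by positivity
  let η : ContDiffBump y := ⟨r / 2, r, half_pos hr, half_lt_self hr⟩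
  have h1 := hc.mono (y' := y) (ρ' := r) (by simp [r]) id contDiff_id (fun x _ => by simp [hr.le])
    (η.normed μ) η.contDiff_normed (η.tsupport_normed_eq (μ := μ)).subset
  have h2 : jacobianIntegral μ id U (η.normed μ) = 1 := by
    simp only [jacobianIntegral, fderiv_id, id]
    have : ∀ x, η.normed μ x * (ContinuousLinearMap.id ℝ E).det = η.normed μ x := by
      intro x; simp [ContinuousLinearMap.det]
    simp only [this]
    rw [setIntegral_eq_integral_of_forall_compl_eq_zero, η.integral_normed]
    intro x hx
    by_contra hne
    have hm : x ∈ Function.support (η.normed μ) := hne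
    rw [η.support_normed_eq] at hm
    exact hx (h (ball_subset_ball (min_le_right _ _) hm))
  rw [h2, η.integral_normed, mul_one] at h1
  exact ⟨ρ, hρ, h1 ▸ hc⟩

theorem degree_eq_of_isPreconnected {f : E → E} (hf : Continuous f) {U : Set E} (hU : IsOpen U)
    (hb : Bornology.IsBounded U) {s : Set E} (hs : IsPreconnected s)
    (hfs : Disjoint s (f '' frontier U)) {y z : E} (hy : y ∈ s) (hz : z ∈ s) :
    degree μ f U y = degree μ f U z := by
  refine hs.induction₂ (fun y z => degree μ f U y = degree μ f U z) (fun x hx => ?_)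
    (fun _ _ _ _ _ _ => Eq.trans) (fun _ _ _ _ => Eq.symm) hy hz
  have := (hasDegree_degree (μ := μ) hf hU hb (Set.disjoint_left.1 hfs hx)).eventually
  filter_upwards [nhdsWithin_le_nhds this] with w hw using (hw.degree_eq hf).symm

theorem degree_eq_zero {f : E → E} (hf : Continuous f) {U : Set E} (hU : IsOpen U)
    (hb : Bornology.IsBounded U) {y : E} (hy : y ∉ f '' closure U) : degree μ f U y = 0 :=
  (hasDegree_zero hf hU hb hy).degree_eq hf

variable (μ)

theorem jacobianIntegral_eq_integral_mul_degree {f g : E → E} (hf : Continuous f) {U : Set E}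
    (hU : IsOpen U) (hb : Bornology.IsBounded U) {ψ : E → ℝ} (hψ : ContDiff ℝ 1 ψ)
    (hψc : HasCompactSupport ψ) {ρ : ℝ} (hρ : 0 < ρ)
    (h : ∀ x ∈ frontier U, ∀ u ∈ tsupport ψ, 4 * ρ ≤ dist (f x) u) (hg : ContDiff ℝ 2 g)
    (hgf : ∀ x ∈ frontier U, dist (g x) (f x) ≤ ρ) :
    jacobianIntegral μ g U ψ = ∫ z, ψ z * degree μ f U z ∂μ := by
  let η : ContDiffBump (0 : E) := ⟨ρ / 2, ρ, half_pos hρ, half_lt_self hρ⟩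
  have hη : η.rOut = ρ := rfl
  rw [jacobianIntegral_eq_integral_mul μ hU hb hg hψ hψc η]
  · congr 1
    ext1 z
    by_cases hz : z ∈ tsupport ψ
    · congr 1
      obtain ⟨c, hc⟩ := exists_hasDegreeWith μ hf hU hb hρ fun x hx => h x hx z hz
      have hdeg : HasDegree μ f U z c := ⟨ρ, hρ, hc⟩
      rw [hdeg.degree_eq hf, hc g hg hgf, integral_sub_right_eq_self (η.normed μ) z,
        η.integral_normed, mul_one]
      · exact (η.contDiff_normed (n := 1)).comp (contDiff_id.sub contDiff_const)
      · refine (tsupport_comp_subset_preimage (η.normed μ) (f := fun u : E => u - z)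
          (by fun_prop)).trans ?_
        rw [η.tsupport_normed_eq, hη]
        intro u hu
        rwa [mem_preimage, mem_closedBall_zero_iff, ← dist_eq_norm] at hu
    · simp [image_eq_zero_of_notMem_tsupport hz]
  · intro x hx u hu
    linarith [h x hx u hu, hgf x hx, dist_triangle (f x) (g x) u, dist_comm (f x) (g x)]

/-- If `G` maps `Y` to `X`, there is a density `ψ` such that integrating against `ψ` the degree over
`U` of any right inverse `X → Y` of `G` tells whether `p` belongs to `U`. -/
theorem exists_integral_mul_degree_eq {X Y : Set E} (hX : IsCompact X) (hY : IsCompact Y)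
    {G : E → E} (hG : Continuous G) (hGY : MapsTo G Y X) {p : E} (hp : p ∉ X) (R : ℝ) :
    ∃ ψ : E → ℝ, Continuous ψ ∧ HasCompactSupport ψ ∧ Disjoint (tsupport ψ) Y ∧
      ∀ F : E → E, Continuous F → (∀ x, ‖F x‖ ≤ R) → MapsTo F X Y → (∀ x ∈ X, G (F x) = x) →
        ∀ U : Set E, IsOpen U → Bornology.IsBounded U → frontier U ⊆ X →
          ∫ z, ψ z * degree μ F U z ∂μ = U.indicator 1 p := by
  obtain ⟨ρ, hρ, hXp⟩ := exists_pos_forall_mul_le_dist hX isClosed_singleton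
    (disjoint_singleton_right.2 hp) (C := 8) (by norm_num)
  replace hXp : ∀ x ∈ X, 8 * ρ ≤ dist x p := fun x hx => hXp x hx p rfl
  obtain ⟨G', hG', hGG'⟩ := exists_contDiff_dist_le hG hρ
  let φ : ContDiffBump p := ⟨ρ / 2, ρ, half_pos hρ, half_lt_self hρ⟩
  let χ : ContDiffBump (0 : E) := ⟨|R| + 1, |R| + 2, by positivity, by linarith⟩
  set ψ : E → ℝ := fun z => χ z * (φ.normed μ (G' z) * (fderiv ℝ G' z).det) with hψ
  have hψc : HasCompactSupport ψ := χ.hasCompactSupport.mul_right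
  have hψd : ContDiff ℝ 1 ψ := by
    have hd : ContDiff ℝ 1 fun z =>
        (Module.finBasis ℝ E).detCMM fun k => fderiv ℝ G' z (Module.finBasis ℝ E k) :=
      (Module.finBasis ℝ E).detCMM.contDiff.comp (contDiff_pi.2 fun j =>
        (hG'.fderiv_right (by norm_num)).clm_apply contDiff_const)
    simp only [Module.Basis.detCMM_clm_apply] at hd
    exact (χ.contDiff (n := 1)).mul
      (((φ.contDiff_normed (n := 1)).comp (hG'.of_le one_le_two)).mul hd)
  have hsupp : ∀ z ∈ tsupport ψ, dist (G' z) p ≤ ρ := by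
    have : tsupport ψ ⊆ G' ⁻¹' closedBall p ρ := by
      refine closure_minimal (fun z hz => ?_) (isClosed_closedBall.preimage hG'.continuous)
      have h1 : G' z ∈ Function.support (φ.normed μ) := fun h0 => hz (by simp [hψ, h0])
      rw [φ.support_normed_eq] at h1
      exact ball_subset_closedBall h1
    exact this
  have hdisj : Disjoint (tsupport ψ) Y := by
    rw [Set.disjoint_left]
    intro z hz hzY
    linarith [hsupp z hz, hGG' z, hXp _ (hGY hzY), dist_triangle (G z) (G' z) p,
      dist_comm (G z) (G' z)]
  refine ⟨ψ, hψd.continuous, hψc, hdisj, fun F hF hFR hFX hGF U hU hb hUX => ?_⟩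
  obtain ⟨ρ₁, hρ₁, h4⟩ := exists_pos_forall_mul_le_dist hY (isClosed_tsupport ψ) hdisj.symm
    (C := 4) (by norm_num)
  obtain ⟨δ, hδ, hδG⟩ : ∃ δ > 0, ∀ y ∈ Y, ∀ z, dist z y ≤ δ → dist (G' z) (G' y) ≤ ρ := by
    have := hY.uniformContinuousAt_of_continuousAt G'
      (fun y _ => hG'.continuous.continuousAt) (Metric.dist_mem_uniformity hρ)
    obtain ⟨δ, hδ, h⟩ := Metric.mem_uniformity_dist.1 this
    refine ⟨δ / 2, half_pos hδ, fun y hy z hz => ?_⟩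
    have h5 : dist y z < δ := by rw [dist_comm]; linarith
    have h6 : dist (G' y) (G' z) < ρ := h h5 hy
    rw [dist_comm]
    exact h6.le
  have hm : 0 < min ρ₁ (min δ 1) := by positivity
  obtain ⟨F', hF', hFF'⟩ := exists_contDiff_dist_le hF hm
  rw [← jacobianIntegral_eq_integral_mul_degree μ hF hU hb hψd hψc hρ₁
    (fun x hx u hu => h4 _ (hFX (hUX hx)) u hu) hF' (fun x _ => (hFF' x).trans (min_le_left _ _))]
  have hcomp : jacobianIntegral μ F' U ψ = jacobianIntegral μ (G' ∘ F') U (φ.normed μ) := by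
    simp only [jacobianIntegral]
    congr 1
    ext1 x
    have h1 : χ (F' x) = 1 := χ.one_of_mem_closedBall <| by
      rw [mem_closedBall_zero_iff]
      have h2 := (hFF' x).trans ((min_le_right _ _).trans (min_le_right _ _))
      rw [dist_eq_norm] at h2
      have h3 : χ.rIn = |R| + 1 := rfl
      have h4 := norm_le_norm_add_norm_sub' (F' x) (F x)
      linarith [hFR x, le_abs_self R]
    rw [fderiv_comp x (hG'.differentiable two_ne_zero _) (hF'.differentiable two_ne_zero _)]
    have h2 : ((fderiv ℝ G' (F' x)).comp (fderiv ℝ F' x)).det =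
        (fderiv ℝ G' (F' x)).det * (fderiv ℝ F' x).det := LinearMap.det_comp _ _
    rw [h2]
    simp only [hψ, h1, Function.comp_apply]
    ring
  have hpU : p ∉ frontier U := fun h => hp (hUX h)
  have hid : HasDegree μ id U p (U.indicator 1 p) := by
    by_cases hpm : p ∈ U
    · simpa [hpm] using hasDegree_id hU hb hpm
    · rw [indicator_of_notMem hpm]
      refine hasDegree_zero continuous_id hU hb ?_
      rw [image_id, closure_eq_self_union_frontier]
      exact fun h => h.elim hpm hpU
  obtain ⟨c, hc⟩ := exists_hasDegreeWith μ continuous_id hU hb (y := p) (ρ := 2 * ρ)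
    (by positivity) fun x hx => by simp only [id]; linarith [hXp x (hUX hx)]
  have hdeg : HasDegree μ id U p c := ⟨2 * ρ, by positivity, hc⟩
  rw [hcomp, hid.unique continuous_id hdeg, hc _ (hG'.comp hF'), φ.integral_normed, mul_one]
  · intro x hx
    have hxX := hUX hx
    have h1 := hδG _ (hFX hxX) (F' x) ((hFF' x).trans ((min_le_right _ _).trans (min_le_left _ _)))
    have h2 := hGG' (F x)
    rw [hGF x hxX] at h2
    simp only [Function.comp_apply, id]
    linarith [dist_triangle (G' (F' x)) (G' (F x)) x]
  · exact φ.contDiff_normed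
  · rw [φ.tsupport_normed_eq]
    exact closedBall_subset_closedBall (by change ρ ≤ 2 * ρ; linarith)

end Haar

/-- If a compact set `X` is homeomorphic to the unit sphere, two bounded open sets whose frontiers
lie in `X` are not disjoint. -/
theorem not_disjoint_of_frontier_subset {X : Set E} (hX : IsCompact X) {F G : E → E}
    (hF : Continuous F) (hG : Continuous G) (hF1 : ∀ x, ‖F x‖ ≤ 1) (hFX : MapsTo F X (sphere 0 1))
    (hGX : MapsTo G (sphere 0 1) X) (hGF : ∀ x ∈ X, G (F x) = x) {U V : Set E}
    (hU : IsOpen U) (hUb : Bornology.IsBounded U) (hUX : frontier U ⊆ X)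
    (hV : IsOpen V) (hVb : Bornology.IsBounded V) (hVX : frontier V ⊆ X)
    {p q : E} (hp : p ∈ U) (hpX : p ∉ X) (hq : q ∈ V) (hqX : q ∉ X) : ¬ Disjoint U V := by
  borelize E
  set μ : Measure E := Measure.addHaar
  have key : ∀ U : Set E, IsOpen U → Bornology.IsBounded U → frontier U ⊆ X → ∀ ψ : E → ℝ,
      Disjoint (tsupport ψ) (sphere 0 1) →
      ∫ z, ψ z * degree μ F U z ∂μ = degree μ F U 0 * ∫ z in ball 0 1, ψ z ∂μ := by
    intro U hU hUb hUX ψ hψ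
    rw [← integral_const_mul, ← integral_indicator measurableSet_ball]
    congr 1
    ext1 z
    rcases lt_trichotomy ‖z‖ 1 with hz | hz | hz
    · have hz' : z ∈ ball (0 : E) 1 := mem_ball_zero_iff.2 hz
      rw [indicator_of_mem hz', mul_comm, degree_eq_of_isPreconnected hF hU hUb
        (convex_ball (0 : E) 1).isPreconnected ?_ hz' (mem_ball_self one_pos)]
      rw [Set.disjoint_right]
      rintro _ ⟨x, hx, rfl⟩ hb
      exact (mem_ball_zero_iff.1 hb).ne (mem_sphere_zero_iff_norm.1 (hFX (hUX hx)))
    · have : z ∉ tsupport ψ := Set.disjoint_right.1 hψ (mem_sphere_zero_iff_norm.2 hz)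
      rw [image_eq_zero_of_notMem_tsupport this, indicator_of_notMem]
      · simp
      · simp [hz]
    · rw [indicator_of_notMem (by simpa using hz.le), degree_eq_zero hF hU hUb, mul_zero]
      rintro ⟨x, -, rfl⟩
      exact hz.not_ge (hF1 x)
  intro hUV
  obtain ⟨ψ, -, -, hψ, h1⟩ := exists_integral_mul_degree_eq μ hX (isCompact_sphere 0 1) hG hGX hpX 1
  obtain ⟨ψ', -, -, hψ', h2⟩ :=
    exists_integral_mul_degree_eq μ hX (isCompact_sphere 0 1) hG hGX hqX 1
  replace h1 := h1 F hF hF1 hFX hGF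
  replace h2 := h2 F hF hF1 hFX hGF
  have e1 := h1 U hU hUb hUX
  have e2 := h1 V hV hVb hVX
  have e3 := h2 V hV hVb hVX
  rw [key U hU hUb hUX ψ hψ, indicator_of_mem hp] at e1
  rw [key V hV hVb hVX ψ hψ, indicator_of_notMem (Set.disjoint_left.1 hUV hp)] at e2
  rw [key V hV hVb hVX ψ' hψ', indicator_of_mem hq] at e3
  rcases mul_eq_zero.1 e2 with h | h <;> simp [h] at e1 e3

/-- If a compact set `X` is homeomorphic to the unit sphere, some component of its complement is
bounded. -/
theorem exists_isBounded_connectedComponentIn {X : Set E} (hX : IsCompact X) {F G : E → E}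
    (hF : Continuous F) (hG : Continuous G) {R : ℝ} (hGR : ∀ x, ‖G x‖ ≤ R)
    (hFX : MapsTo F X (sphere 0 1)) (hGX : MapsTo G (sphere 0 1) X)
    (hFG : ∀ y ∈ sphere (0 : E) 1, F (G y) = y) :
    ∃ p ∉ X, Bornology.IsBounded (connectedComponentIn Xᶜ p) := by
  by_contra! hcon
  borelize E
  set μ : Measure E := Measure.addHaar
  have hfr : frontier (ball (0 : E) 1) ⊆ sphere 0 1 := frontier_ball_subset_sphere
  obtain ⟨ψ, -, -, hψ, h⟩ := exists_integral_mul_degree_eq μ (isCompact_sphere (0 : E) 1) hX hF hFX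
    (p := 0) (by simp) R
  have h1 := h G hG hGR hGX hFG (ball 0 1) isOpen_ball isBounded_ball hfr
  have h2 : ∀ z, ψ z * degree μ G (ball 0 1) z = 0 := fun z => by
    by_cases hz : z ∈ X
    · rw [image_eq_zero_of_notMem_tsupport (Set.disjoint_right.1 hψ hz), zero_mul]
    · obtain ⟨w, hw, hwR⟩ : ∃ w ∈ connectedComponentIn Xᶜ z, w ∉ closedBall 0 R := by
        by_contra! hsub
        exact hcon z hz (isBounded_closedBall.subset hsub)
      rw [degree_eq_of_isPreconnected hG isOpen_ball isBounded_ball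
        isPreconnected_connectedComponentIn ?_ (mem_connectedComponentIn hz) hw,
        degree_eq_zero hG isOpen_ball isBounded_ball, mul_zero]
      · rintro ⟨x, -, rfl⟩
        exact hwR (mem_closedBall_zero_iff.2 (hGR x))
      · rw [Set.disjoint_right]
        rintro _ ⟨x, hx, rfl⟩ hmem
        exact connectedComponentIn_subset _ _ hmem (hGX (hfr hx))
  simp [h2] at h1

variable {V : Type*} [NormedAddCommGroup V] [InnerProductSpace ℝ V] [FiniteDimensional ℝ V]

/-- A compact subset of the image of a punctured sphere does not bound. -/
theorem subset_range_of_frontier_subset {f : sphere (0 : V) 1 → V} (hf : Continuous f)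
    (hfi : Function.Injective f) (v : sphere (0 : V) 1) {Ω : Set V} (hΩ : IsOpen Ω)
    (hb : Bornology.IsBounded Ω) (hfr : frontier Ω ⊆ f '' {v}ᶜ) : Ω ⊆ range f := by
  intro p hp
  by_contra hpf
  borelize V
  have hcl : Topology.IsClosedEmbedding f := hf.isClosedEmbedding hfi
  let e := hcl.isEmbedding.toHomeomorph
  have he : ∀ x : sphere (0 : V) 1, e.symm ⟨f x, mem_range_self x⟩ = x := e.symm_apply_apply
  let φ := stereographic (norm_eq_of_mem_sphere v)
  have hrange : ∀ x : frontier Ω, (x : V) ∈ range f := fun x => image_subset_range _ _ (hfr x.2)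
  let k : frontier Ω → sphere (0 : V) 1 := fun x => e.symm ⟨x, hrange x⟩
  have hk : Continuous k := e.symm.continuous.comp (continuous_subtype_val.subtype_mk hrange)
  have hfk : ∀ x, f (k x) = x := fun x => congr_arg Subtype.val (e.apply_symm_apply ⟨x, hrange x⟩)
  have hkv : ∀ x, k x ∈ φ.source := fun x => by
    obtain ⟨y, hy, hyx⟩ := hfr x.2
    have : k x = y := hfi ((hfk x).trans hyx.symm)
    rw [this]
    exact hy
  have : TietzeExtension (Submodule.span ℝ {(v : V)})ᗮ := TietzeExtension.of_tvs ℝ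
  obtain ⟨h, hh⟩ := ContinuousMap.exists_restrict_eq (isClosed_frontier (s := Ω))
    ⟨fun x => φ (k x), φ.continuousOn.comp_continuous hk hkv⟩
  have hφ : Continuous φ.symm := (isOpenEmbedding_stereographic_symm _).continuous
  set r : V → V := fun x => f (φ.symm (h x))
  have hr : Continuous r := hf.comp (hφ.comp h.continuous)
  have heq : EqOn id r (frontier Ω) := fun x hx => by
    have h1 : h x = φ (k ⟨x, hx⟩) := DFunLike.congr_fun hh ⟨x, hx⟩
    simp only [r, id, h1]
    rw [φ.left_inv (hkv _), hfk]
  have h1 := (hasDegree_id (μ := Measure.addHaar) hΩ hb hp).congr heq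
  have h2 := hasDegree_zero (μ := Measure.addHaar) hr hΩ hb (y := p)
    (by rintro ⟨x, -, rfl⟩; exact hpf (mem_range_self _))
  exact one_ne_zero (h1.unique hr h2)

theorem range_subset_frontier {f : sphere (0 : V) 1 → V} (hf : Continuous f)
    (hfi : Function.Injective f) {Ω O : Set V} (hΩ : IsOpen Ω) (hb : Bornology.IsBounded Ω)
    (hΩO : frontier Ω ⊆ frontier O) (hO : frontier O ⊆ range f) {p : V} (hp : p ∈ Ω)
    (hpf : p ∉ range f) : range f ⊆ frontier O := by
  rintro _ ⟨v, rfl⟩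
  by_contra hv
  refine hpf (subset_range_of_frontier_subset hf hfi v hΩ hb (fun x hx => ?_) hp)
  obtain ⟨y, rfl⟩ := hO (hΩO hx)
  exact mem_image_of_mem f fun hy => hv (by rw [← mem_singleton_iff.1 hy]; exact hΩO hx)

theorem exists_isOpen_isConnected_union_eq_compl_range (hV : 1 < Module.rank ℝ V)
    {f : sphere (0 : V) 1 → V} (hf : Continuous f) (hfi : Function.Injective f) :
    ∃ U W : Set V, IsOpen U ∧ IsOpen W ∧ IsConnected U ∧ IsConnected W ∧ Disjoint U W ∧
      U ∪ W = (range f)ᶜ ∧ Bornology.IsBounded U ∧ ¬ Bornology.IsBounded W ∧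
      frontier U = range f ∧ frontier W = range f := by
  have hcl : Topology.IsClosedEmbedding f := hf.isClosedEmbedding hfi
  have hX : IsCompact (range f) := isCompact_range hf
  have hXo : IsOpen (range f)ᶜ := hX.isClosed.isOpen_compl
  obtain ⟨R, hR, hfR⟩ : ∃ R > 0, ∀ x, ‖f x‖ ≤ R := by
    obtain ⟨R, hR, h⟩ := hX.isBounded.exists_pos_norm_le
    exact ⟨R, hR, fun x => h _ (mem_range_self x)⟩
  obtain ⟨G, hG, hGR, hGf⟩ := exists_extension_norm_le isClosed_sphere hR ⟨f, hf⟩ hfR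
  let e := hcl.isEmbedding.toHomeomorph
  have he : ∀ x : sphere (0 : V) 1, e.symm ⟨f x, mem_range_self x⟩ = x := e.symm_apply_apply
  obtain ⟨F, hF, hF1, hFe⟩ := exists_extension_norm_le hX.isClosed one_pos
    ⟨fun x => (e.symm x : V), continuous_subtype_val.comp e.symm.continuous⟩
    fun x => (norm_eq_of_mem_sphere (e.symm x)).le
  have hFf : ∀ x : sphere (0 : V) 1, F (f x) = x := fun x =>
    (hFe ⟨f x, mem_range_self x⟩).trans (congr_arg Subtype.val (he x))
  replace hGf : ∀ x : sphere (0 : V) 1, G x = f x := hGf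
  have hFX : MapsTo F (range f) (sphere 0 1) := by
    rintro _ ⟨x, rfl⟩
    rw [hFf]
    exact x.2
  have hGX : MapsTo G (sphere 0 1) (range f) := fun y hy => ⟨⟨y, hy⟩, (hGf ⟨y, hy⟩).symm⟩
  have hGF : ∀ x ∈ range f, G (F x) = x := by
    rintro _ ⟨x, rfl⟩
    rw [hFf, hGf]
  have hFG : ∀ y ∈ sphere (0 : V) 1, F (G y) = y := fun y hy => by
    rw [hGf ⟨y, hy⟩, hFf]
  obtain ⟨p, hp, hpb⟩ := exists_isBounded_connectedComponentIn hX hF hG hGR hFX hGX hFG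
  set C : V → Set V := fun x => connectedComponentIn (range f)ᶜ x with hC
  have hCo : ∀ x, IsOpen (C x) := fun x => hXo.connectedComponentIn
  have hCf : ∀ x, frontier (C x) ⊆ range f := fun x => by
    simpa using frontier_connectedComponentIn_subset hXo x
  have hCm : ∀ {x}, x ∉ range f → x ∈ C x := fun hx => mem_connectedComponentIn hx
  have hCs : ∀ x, C x ⊆ (range f)ᶜ := fun x => connectedComponentIn_subset _ x
  have hCeq : ∀ {x y z}, z ∈ C x → z ∈ C y → C x = C y := fun h h' =>
    (connectedComponentIn_eq h).trans (connectedComponentIn_eq h').symm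
  have hBsub : (closedBall (0 : V) R)ᶜ ⊆ (range f)ᶜ := by
    refine compl_subset_compl.2 ?_
    rintro _ ⟨x, rfl⟩
    exact mem_closedBall_zero_iff.2 (hfR x)
  have : Nontrivial V := rank_pos_iff_nontrivial.1 (zero_lt_one.trans hV)
  obtain ⟨q, hq⟩ : ∃ q : V, R < ‖q‖ := NormedSpace.exists_lt_norm ℝ V R
  have hqB : q ∈ (closedBall (0 : V) R)ᶜ := by simpa using hq
  have hBW : (closedBall (0 : V) R)ᶜ ⊆ C q :=
    (isPreconnected_compl_closedBall hV hR.le).subset_connectedComponentIn hqB hBsub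
  have hqb : ¬ Bornology.IsBounded (C q) := fun h => by
    obtain ⟨M, hM⟩ := h.exists_norm_le
    obtain ⟨w, hw⟩ := NormedSpace.exists_lt_norm ℝ V (max M R)
    have := hM w (hBW (by simpa using (le_max_right _ _).trans_lt hw))
    exact this.not_gt ((le_max_left _ _).trans_lt hw)
  have hdisj : Disjoint (C p) (C q) := Set.disjoint_left.2 fun z hz hz' =>
    hqb (hCeq hz hz' ▸ hpb)
  refine ⟨C p, C q, hCo p, hCo q, isConnected_connectedComponentIn_iff.2 hp,
    isConnected_connectedComponentIn_iff.2 (hBsub hqB), hdisj, ?_, hpb, hqb,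
    (hCf p).antisymm ?_, (hCf q).antisymm ?_⟩
  · refine (union_subset (hCs p) (hCs q)).antisymm fun z hz => ?_
    by_contra hcon
    rw [mem_union, not_or] at hcon
    have hzb : Bornology.IsBounded (C z) := isBounded_closedBall.subset fun w hw => by
      by_contra hwB
      exact hcon.2 (hCeq hw (hBW hwB) ▸ hCm hz)
    refine not_disjoint_of_frontier_subset hX hF hG hF1 hFX hGX hGF (hCo p) hpb (hCf p) (hCo z) hzb
      (hCf z) (hCm hp) hp (hCm hz) hz (Set.disjoint_left.2 fun w hw hw' => ?_)
    exact hcon.1 (hCeq hw hw' ▸ hCm hz)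
  · exact range_subset_frontier hf hfi (hCo p) hpb subset_rfl (hCf p) (hCm hp) hp
  · refine range_subset_frontier hf hfi (Ω := (closure (C q))ᶜ) isClosed_closure.isOpen_compl
      ((isBounded_closedBall (x := 0) (r := R)).subset ?_) ?_ (hCf q) (p := p) ?_ hp
    · exact compl_subset_comm.1 (hBW.trans subset_closure)
    · rw [frontier_compl]
      exact frontier_closure_subset
    · exact Set.disjoint_left.1 (hdisj.closure_right (hCo p)) (hCm hp)

end JordanBrouwer

/-- **Jordan–Brouwer separation theorem.** If `X ⊆ ℝ^{d+1}` is the image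
of an injective continuous map from the `d`-sphere (`d > 0`), then `ℝ^{d+1} \ X` has
exactly two connected components — both open and connected, one bounded and one
unbounded — and `X` is the topological frontier of each of them. -/
theorem stmt5 (d : ℕ) (hd : 0 < d)
    (f : ↥(sphere (0 : EuclideanSpace ℝ (Fin (d + 1))) 1) →
         EuclideanSpace ℝ (Fin (d + 1)))
    (hfc : Continuous f) (hfi : Function.Injective f) :
    ∃ U W : Set (EuclideanSpace ℝ (Fin (d + 1))),
      IsOpen U ∧ IsOpen W ∧ IsConnected U ∧ IsConnected W ∧ Disjoint U W ∧
      U ∪ W = (Set.range f)ᶜ ∧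
      Bornology.IsBounded U ∧ ¬ Bornology.IsBounded W ∧
      frontier U = Set.range f ∧ frontier W = Set.range f := by
  refine exists_isOpen_isConnected_union_eq_compl_range ?_ hfc hfi
  rw [← Module.finrank_eq_rank, finrank_euclideanSpace_fin]
  exact_mod_cast Nat.succ_lt_succ hd
end

section
/- Let φ : S^{n−1} → S^n be a locally flat topological embedding with n ≥ 2, and let A be the closure of one of the connected components of S^n \ φ(S^{n−1}). Then A is homeomorphic to the closed n-dimensional ball D^n. -/
open Metric

section

open MeasureTheory Polynomial

theorem det_one_add_smul_eq_sum {E : Type*} [NormedAddCommGroup E] [NormedSpace ℝ E]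
    [FiniteDimensional ℝ E] (A : E →L[ℝ] E) (t : ℝ) :
    (ContinuousLinearMap.id ℝ E + t • A).det =
      ∑ i ∈ Finset.range (Module.finrank ℝ E + 1),
        (Lagrange.basis (Finset.range (Module.finrank ℝ E + 1)) (fun i : ℕ ↦ (i : ℝ)) i).eval t *
          (ContinuousLinearMap.id ℝ E + (i : ℝ) • A).det := by
  classical
  let b := Module.finBasis ℝ E
  let M := LinearMap.toMatrix b b (A : E →ₗ[ℝ] E)
  let P : ℝ[X] := ((X : ℝ[X]) • M.map C + (1 : Matrix _ _ ℝ).map C).det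
  have hP : ∀ s : ℝ, P.eval s = (ContinuousLinearMap.id ℝ E + s • A).det := by
    intro s
    rw [ContinuousLinearMap.det, ← LinearMap.det_toMatrix b, ← Polynomial.coe_evalRingHom,
      RingHom.map_det]
    refine congrArg Matrix.det ?_
    have h : (((ContinuousLinearMap.id ℝ E + s • A : E →L[ℝ] E)) : E →ₗ[ℝ] E) =
        LinearMap.id + s • (A : E →ₗ[ℝ] E) := rfl
    rw [h, (LinearMap.toMatrix b b).map_add, (LinearMap.toMatrix b b).map_smul,
      LinearMap.toMatrix_id]
    ext i j
    by_cases hij : i = j <;> simp [M, hij] <;> ring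
  have hdeg : P.degree < (Finset.range (Module.finrank ℝ E + 1)).card := by
    have h := Polynomial.natDegree_det_X_add_C_le M 1
    rw [Fintype.card_fin] at h
    rw [Finset.card_range]
    exact lt_of_le_of_lt Polynomial.degree_le_natDegree (by exact_mod_cast Nat.lt_succ_of_le h)
  have hinj : Set.InjOn (fun i : ℕ ↦ (i : ℝ)) (Finset.range (Module.finrank ℝ E + 1)) :=
    Nat.cast_injective.injOn
  have h := congrArg (Polynomial.eval t) (Lagrange.eq_interpolate hinj hdeg)
  rw [hP] at h
  rw [h, Lagrange.interpolate_apply, Polynomial.eval_finsetSum]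
  refine Finset.sum_congr rfl fun i _ ↦ ?_
  rw [Polynomial.eval_mul, Polynomial.eval_C, hP, mul_comm]

section Brouwer

variable {E : Type*} [NormedAddCommGroup E] [InnerProductSpace ℝ E] [FiniteDimensional ℝ E]

/-- Small perturbations `x + t g(x)` of the identity by a `C¹` map vanishing on the boundary
sphere restrict to bijections of the open ball. -/
theorem eventually_perturbation_bijective {ρ : ℝ} (hρ : 0 < ρ) {g : E → E} (hg : ContDiff ℝ 1 g)
    (hgB : ∀ x, ‖x + g x‖ ≤ ρ) (hgS : ∀ x, ‖x‖ = ρ → g x = 0) :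
    ∀ᶠ t in nhdsWithin (0 : ℝ) (Set.Ioi 0),
      (∀ x ∈ ball (0 : E) ρ, 0 < (ContinuousLinearMap.id ℝ E + t • fderiv ℝ g x).det) ∧
      Set.InjOn (fun x ↦ x + t • g x) (ball (0 : E) ρ) ∧
      (fun x ↦ x + t • g x) '' ball (0 : E) ρ = ball 0 ρ := by
  have hcomp : IsCompact (closedBall (0 : E) ρ) := isCompact_closedBall _ _
  obtain ⟨K, hK⟩ := (hg.locallyLipschitz.locallyLipschitzOn
    (s := closedBall (0 : E) ρ)).exists_lipschitzOnWith_of_compact hcomp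
  have hcont : Continuous fun z : ℝ × E ↦
      (ContinuousLinearMap.id ℝ E + z.1 • fderiv ℝ g z.2).det := by
    have := hg.continuous_fderiv one_ne_zero
    exact ContinuousLinearMap.continuous_det.comp (by fun_prop)
  have hdet : ∀ᶠ t in nhds (0 : ℝ), ∀ x ∈ closedBall (0 : E) ρ,
      0 < (ContinuousLinearMap.id ℝ E + t • fderiv ℝ g x).det := by
    refine hcomp.eventually_forall_of_forall_eventually fun y _ ↦ ?_
    refine hcont.continuousAt.eventually (lt_mem_nhds ?_)
    simp [ContinuousLinearMap.det]
  have hlip : ∀ᶠ t : ℝ in nhds 0, t * K < 1 := by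
    refine Filter.Tendsto.eventually_lt_const (v := 0 * (K : ℝ)) (by simp) ?_
    exact (continuous_id.mul continuous_const).tendsto 0
  filter_upwards [hdet.filter_mono nhdsWithin_le_nhds, hlip.filter_mono nhdsWithin_le_nhds,
    (gt_mem_nhds (zero_lt_one (α := ℝ))).filter_mono nhdsWithin_le_nhds,
    self_mem_nhdsWithin] with t ht1 ht2 ht4 ht3
  have ht3 : 0 < t := ht3
  have hbound : ∀ x, ‖x‖ < ρ → ‖x + t • g x‖ < ρ := by
    intro x hx
    have : x + t • g x = (1 - t) • x + t • (x + g x) := by module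
    rw [this]
    refine (norm_add_le _ _).trans_lt ?_
    rw [norm_smul, norm_smul, Real.norm_of_nonneg ht3.le, Real.norm_of_nonneg (by linarith)]
    nlinarith [hgB x]
  have hsub : (fun x ↦ x + t • g x) '' ball (0 : E) ρ ⊆ ball 0 ρ := by
    rintro _ ⟨x, hx, rfl⟩
    rw [mem_ball_zero_iff] at hx ⊢
    exact hbound x hx
  refine ⟨fun x hx ↦ ht1 x (ball_subset_closedBall hx), ?_, hsub.antisymm ?_⟩
  · intro x hx y hy hxy
    have h1 := hK.dist_le_mul x (ball_subset_closedBall hx) y (ball_subset_closedBall hy)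
    have h2 : x - y = t • (g y - g x) := by
      have : x + t • g x = y + t • g y := hxy
      rw [smul_sub, sub_eq_sub_iff_add_eq_add, this, add_comm]
    have h3 : dist x y = t * dist (g x) (g y) := by
      rw [dist_eq_norm, h2, norm_smul, Real.norm_of_nonneg ht3.le, dist_comm, dist_eq_norm]
    by_contra hne
    have := dist_pos.2 hne
    nlinarith
  · refine (convex_ball (0 : E) ρ).isPreconnected.subset_of_closure_inter_subset ?_ ?_ ?_
    · rw [isOpen_iff_mem_nhds]
      rintro _ ⟨x, hx, rfl⟩
      have hs : HasStrictFDerivAt (fun x ↦ x + t • g x)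
          (ContinuousLinearMap.id ℝ E + t • fderiv ℝ g x) x :=
        (hasStrictFDerivAt_id x).add
          ((hg.contDiffAt.hasStrictFDerivAt one_ne_zero).const_smul t)
      have hne := (ht1 x (ball_subset_closedBall hx)).ne'
      rw [← hs.map_nhds_eq_of_surj ?_]
      · exact Filter.image_mem_map (isOpen_ball.mem_nhds hx)
      · exact LinearMap.range_eq_top.2
          (LinearMap.equivOfDetNeZero _ hne).surjective
    · exact ⟨_, hsub ⟨0, mem_ball_self hρ, rfl⟩, ⟨0, mem_ball_self hρ, rfl⟩⟩
    · rintro y ⟨hy, hyB⟩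
      have hcl : closure ((fun x ↦ x + t • g x) '' ball (0 : E) ρ) ⊆
          (fun x ↦ x + t • g x) '' closedBall (0 : E) ρ := by
        refine closure_minimal (Set.image_mono ball_subset_closedBall) ?_
        have := hg.continuous
        exact (hcomp.image (by fun_prop)).isClosed
      obtain ⟨x, hx, rfl⟩ := hcl hy
      rcases (mem_closedBall_zero_iff.1 hx).lt_or_eq with h | h
      · exact ⟨x, mem_ball_zero_iff.2 h, rfl⟩
      · simp [hgS x h, h] at hyB

/-- There is no `C¹` retraction onto a sphere. -/
theorem not_exists_contDiff_retraction {ρ : ℝ} (hρ : 0 < ρ) {r : E → E} (hr : ContDiff ℝ 1 r)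
    (hrS : ∀ x, ‖r x‖ = ρ) (hrid : ∀ x, ‖x‖ = ρ → r x = x) : False := by
  borelize E
  let g : E → E := fun x ↦ r x - x
  have hg : ContDiff ℝ 1 g := hr.sub contDiff_id
  let D : ℝ → E → ℝ := fun t x ↦ (ContinuousLinearMap.id ℝ E + t • fderiv ℝ g x).det
  have hDcont : ∀ t, Continuous (D t) := fun t ↦ by
    have := hg.continuous_fderiv one_ne_zero
    exact ContinuousLinearMap.continuous_det.comp (by fun_prop)
  have hDint : ∀ t, IntegrableOn (D t) (ball 0 ρ) := fun t ↦
    ((hDcont t).continuousOn.integrableOn_compact (isCompact_closedBall _ _)).mono_set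
      ball_subset_closedBall
  let P : ℝ[X] := ∑ i ∈ Finset.range (Module.finrank ℝ E + 1),
    C (∫ x in ball 0 ρ, D i x) *
      Lagrange.basis (Finset.range (Module.finrank ℝ E + 1)) (fun i : ℕ ↦ (i : ℝ)) i
  have hP : ∀ t, P.eval t = ∫ x in ball 0 ρ, D t x := by
    intro t
    have : D t = fun x ↦ ∑ i ∈ Finset.range (Module.finrank ℝ E + 1),
        (Lagrange.basis (Finset.range (Module.finrank ℝ E + 1)) (fun i : ℕ ↦ (i : ℝ)) i).eval t *
          D i x := funext fun x ↦ det_one_add_smul_eq_sum _ t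
    simp_rw [this]
    rw [integral_finsetSum _ fun (i : ℕ) _ ↦ (hDint (i : ℝ)).const_mul _,
      Polynomial.eval_finsetSum]
    refine Finset.sum_congr rfl fun i _ ↦ ?_
    rw [Polynomial.eval_mul, Polynomial.eval_C, integral_const_mul, mul_comm]
  have hsmall : ∀ᶠ t in nhdsWithin (0 : ℝ) (Set.Ioi 0),
      P.eval t = (volume (ball (0 : E) ρ)).toReal := by
    filter_upwards [eventually_perturbation_bijective hρ hg (fun x ↦ by simp [g, hrS x])
      (fun x hx ↦ by simp [g, hrid x hx])] with t ⟨h1, h2, h3⟩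
    have h4 := lintegral_abs_det_fderiv_eq_addHaar_image volume (f := fun x ↦ x + t • g x)
      (f' := fun x ↦ ContinuousLinearMap.id ℝ E + t • fderiv ℝ g x)
      (measurableSet_ball (x := (0 : E)) (ε := ρ)) (fun x _ ↦ ?_) h2
    · rw [h3] at h4
      rw [hP, ← h4, integral_eq_lintegral_of_nonneg_ae]
      · congr 1
        refine setLIntegral_congr_fun measurableSet_ball fun x hx ↦ ?_
        simp only [D]
        rw [abs_of_pos (h1 x hx)]
      · exact (ae_restrict_mem measurableSet_ball).mono fun x hx ↦ (h1 x hx).le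
      · exact (hDcont t).aestronglyMeasurable
    · exact ((hasFDerivAt_id x).add
        (((hg.differentiable one_ne_zero) x).hasFDerivAt.const_smul t)).hasFDerivWithinAt
  have hPC : P = C (volume (ball (0 : E) ρ)).toReal := by
    refine Polynomial.eq_of_infinite_eval_eq _ _ ?_
    simp only [Polynomial.eval_C]
    obtain ⟨ε, hε, hsub⟩ := mem_nhdsGT_iff_exists_Ioo_subset.1 hsmall
    exact (Set.Ioo_infinite hε).mono hsub
  have hone : ∫ x in ball (0 : E) ρ, D 1 x = 0 := by
    refine integral_eq_zero_of_ae (.of_forall fun x ↦ ?_)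
    have hd : ContinuousLinearMap.id ℝ E + (1 : ℝ) • fderiv ℝ g x = fderiv ℝ r x := by
      have : fderiv ℝ g x = fderiv ℝ r x - ContinuousLinearMap.id ℝ E := by
        have := fderiv_fun_sub (𝕜 := ℝ) ((hr.differentiable one_ne_zero) x)
          (differentiableAt_fun_id (x := x))
        simpa [g] using this
      rw [this]; simp
    simp only [D, hd, Pi.zero_apply]
    by_contra hne
    obtain ⟨v, hv⟩ := (LinearMap.equivOfDetNeZero _ hne).surjective (r x)
    have hv : fderiv ℝ r x v = r x := hv
    have h1 := (((hr.differentiable one_ne_zero) x).hasFDerivAt.norm_sq)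
    have h2 : (fun y ↦ ‖r y‖ ^ 2) = fun _ ↦ ρ ^ 2 := by ext y; rw [hrS]
    rw [h2] at h1
    have h3 := congrArg (fun L ↦ L v) (h1.unique (hasFDerivAt_const _ _))
    simp [hv, hrS x, hρ.ne'] at h3
  have h0 := hP 1
  rw [hPC, Polynomial.eval_C, hone] at h0
  have := (ENNReal.toReal_pos (measure_ball_pos volume (0 : E) hρ).ne' measure_ball_lt_top.ne)
  exact this.ne' h0
theorem exists_add_eq_zero_of_contDiff {u : E → E} (hu : ContDiff ℝ 1 u) {R : ℝ} (hR : 0 < R)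
    (hsupp : ∀ x, R ≤ ‖x‖ → u x = 0) : ∃ x, x + u x = 0 := by
  by_contra! hne
  have hF : ContDiff ℝ 1 fun x ↦ x + u x := contDiff_id.add hu
  refine not_exists_contDiff_retraction hR (r := fun x ↦ (R * ‖x + u x‖⁻¹) • (x + u x)) ?_ ?_ ?_
  · exact ((contDiff_const.mul ((hF.norm ℝ hne).inv fun x ↦ norm_ne_zero_iff.2 (hne x)))).smul hF
  · intro x
    rw [norm_smul, norm_mul, norm_inv, norm_norm, Real.norm_of_nonneg hR.le, mul_assoc,
      inv_mul_cancel₀ (norm_ne_zero_iff.2 (hne x)), mul_one]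
  · intro x hx
    simp [hsupp x hx.ge, hx, hR.ne']

theorem exists_add_eq_zero {u : E → E} (hu : Continuous u) {R : ℝ} (hR : 0 < R)
    (hsupp : ∀ x, R ≤ ‖x‖ → u x = 0) : ∃ x, x + u x = 0 := by
  by_contra! hne
  obtain ⟨z, -, hz⟩ := (isCompact_closedBall (0 : E) R).exists_isMinOn
    ⟨0, mem_closedBall_self hR.le⟩ (f := fun x ↦ ‖x + u x‖) (by fun_prop)
  obtain ⟨v, hv, hvu, hvs⟩ := hu.exists_contDiff_approx 1 (ε := fun _ ↦ ‖z + u z‖)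
    continuous_const (fun _ ↦ norm_pos_iff.2 (hne z))
  have hvs' : ∀ x, R ≤ ‖x‖ → v x = 0 := fun x hx ↦ by
    by_contra h
    exact hvs h (hsupp x hx)
  obtain ⟨x, hx⟩ := exists_add_eq_zero_of_contDiff (by exact_mod_cast hv) hR hvs'
  rcases lt_or_ge ‖x‖ R with h | h
  · have h1 : ‖z + u z‖ ≤ ‖x + u x‖ := hz (mem_closedBall_zero_iff.2 h.le)
    have h2 := hvu x
    rw [dist_comm, dist_eq_norm] at h2
    have h3 : u x - v x = x + u x := by rw [eq_neg_of_add_eq_zero_right hx]; abel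
    rw [h3] at h2
    linarith
  · rw [hvs' x h, add_zero] at hx
    simp [hx] at h
    linarith

/-- **Brouwer's fixed point theorem.** -/
theorem exists_fixedPoint_closedBall {w : E → E} (hw : ContinuousOn w (closedBall 0 1))
    (hwB : ∀ x ∈ closedBall (0 : E) 1, ‖w x‖ ≤ 1) : ∃ x ∈ closedBall (0 : E) 1, w x = x := by
  let pr : E → E := fun x ↦ (max 1 ‖x‖)⁻¹ • x
  have hpos : ∀ x : E, 0 < max 1 ‖x‖ := fun x ↦ lt_max_of_lt_left one_pos
  have hprB : ∀ x, pr x ∈ closedBall (0 : E) 1 := fun x ↦ by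
    rw [mem_closedBall_zero_iff, norm_smul, norm_inv, Real.norm_of_nonneg (hpos x).le,
      inv_mul_le_one₀ (hpos x)]
    exact le_max_right _ _
  have hpr : Continuous pr :=
    ((continuous_const.max continuous_norm).inv₀ fun x ↦ (hpos x).ne').smul continuous_id
  let lam : E → ℝ := fun x ↦ max 0 (min 1 (2 - ‖x‖))
  have hlam : Continuous lam := by fun_prop
  obtain ⟨x, hx⟩ := exists_add_eq_zero (u := fun x ↦ -(lam x • w (pr x)))
    (hlam.smul (hw.comp_continuous hpr hprB)).neg (R := 2) two_pos (fun x hx ↦ by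
      have : lam x = 0 := max_eq_left ((min_le_right _ _).trans (by linarith))
      simp [this])
  rw [add_neg_eq_zero] at hx
  have hn : ‖x‖ ≤ lam x := by
    conv_lhs => rw [hx]
    rw [norm_smul, Real.norm_of_nonneg (le_max_left _ _)]
    exact mul_le_of_le_one_right (le_max_left _ _) (hwB _ (hprB x))
  have hx1 : ‖x‖ ≤ 1 := hn.trans (max_le zero_le_one (min_le_left _ _))
  have hl1 : lam x = 1 := by
    simp only [lam]
    rw [min_eq_left (by linarith), max_eq_right zero_le_one]
  have hp1 : pr x = x := by simp [pr, hx1]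
  rw [hl1, hp1, one_smul] at hx
  exact ⟨x, mem_closedBall_zero_iff.2 hx1, hx.symm⟩

/-- The normalized case of invariance of domain. -/
theorem mem_interior_image_closedBall {f : E → E} (hf : ContinuousOn f (closedBall 0 1))
    (hinj : Set.InjOn f (closedBall 0 1)) : f 0 ∈ interior (f '' closedBall 0 1) := by
  borelize E
  set B := closedBall (0 : E) 1 with hB
  have hBc : IsCompact B := isCompact_closedBall _ _
  have hfB : IsCompact (f '' B) := hBc.image_of_continuousOn hf
  have h0B : (0 : E) ∈ B := mem_closedBall_self zero_le_one
  -- a continuous extension of the inverse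
  obtain ⟨G, hG⟩ : ∃ G : C(E, E), ∀ x ∈ B, G (f x) = x := by
    have : CompactSpace B := isCompact_iff_compactSpace.1 hBc
    have hemb : Topology.IsClosedEmbedding (B.domRestrict f) :=
      (continuousOn_iff_continuous_domRestrict.1 hf).isClosedEmbedding
        (Set.injOn_iff_injective.1 hinj)
    obtain ⟨G, hG⟩ := ContinuousMap.exists_extension hemb
      (⟨Subtype.val, continuous_subtype_val⟩ : C(B, E))
    exact ⟨G, fun x hx ↦ congrArg (fun g ↦ g ⟨x, hx⟩) hG⟩
  -- stability of the zero of `G`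
  have hstable : ∀ H : E → E, ContinuousOn H (f '' B) → (∀ y ∈ f '' B, ‖G y - H y‖ ≤ 1) →
      ∃ y ∈ f '' B, H y = 0 := by
    intro H hH hGH
    obtain ⟨x, hxB, hx⟩ := exists_fixedPoint_closedBall (w := fun x ↦ x - H (f x))
      (continuousOn_id.sub (hH.comp hf (Set.mapsTo_image _ _))) (fun x hx ↦ by
        have := hGH (f x) ⟨x, hx, rfl⟩
        rwa [hG x hx] at this)
    exact ⟨f x, ⟨x, hxB, rfl⟩, by simpa using hx⟩
  by_contra hint
  have hG0 : G (f 0) = 0 := hG 0 h0B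
  obtain ⟨ε, hε, hεG⟩ := Metric.continuousAt_iff.1 (G.continuous.continuousAt (x := f 0))
    (1 / 4) (by norm_num)
  obtain ⟨c, hcε, hc⟩ : ∃ c ∈ ball (f 0) (ε / 2), c ∉ f '' B := by
    by_contra! h
    exact hint (mem_interior_iff_mem_nhds.2
      (Filter.mem_of_superset (ball_mem_nhds _ (by positivity)) h))
  set η := ε / 2 with hη
  have hη0 : 0 < η := by positivity
  have hGsmall : ∀ y, dist y c ≤ η → ‖G y‖ < 1 / 4 := by
    intro y hy
    have h1 : dist y (f 0) < ε := by
      have := dist_triangle y c (f 0)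
      rw [mem_ball] at hcε
      linarith
    have := hεG h1
    rwa [hG0, dist_zero_right] at this
  obtain ⟨δ₀, hδ₀, hδG⟩ : ∃ δ, 0 < δ ∧ ∀ y ∈ f '' B ∩ {y | η ≤ dist y c}, δ ≤ ‖G y‖ := by
    refine (hfB.inter_right (isClosed_le continuous_const (by fun_prop))).exists_forall_le'
      (by fun_prop) ?_
    rintro _ ⟨⟨x, hx, rfl⟩, hy⟩
    rw [hG x hx, norm_pos_iff]
    rintro rfl
    rw [mem_ball, dist_comm] at hcε
    exact hcε.not_ge hy
  set δ := min δ₀ (1 / 4) with hδ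
  have hδ0 : 0 < δ := lt_min hδ₀ (by norm_num)
  obtain ⟨P, hP, hPG, -⟩ := G.continuous.exists_contDiff_approx 1 (ε := fun _ ↦ δ / 2)
    continuous_const (fun _ ↦ by positivity)
  have hnull : volume (P '' sphere c η) = 0 :=
    addHaar_image_eq_zero_of_differentiableOn_of_addHaar_eq_zero _
      (hP.differentiable (by simp)).differentiableOn
      (Measure.addHaar_sphere_of_ne_zero _ _ hη0.ne')
  obtain ⟨v, hvδ, hv⟩ : ∃ v ∈ ball (0 : E) (δ / 2), v ∉ P '' sphere c η := by
    by_contra! h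
    exact (measure_ball_pos volume (0 : E) (by positivity)).ne' (measure_mono_null h hnull)
  rw [mem_ball_zero_iff] at hvδ
  have hclose : ∀ y, ‖G y - (P y - v)‖ < δ := by
    intro y
    have h1 := hPG y
    rw [dist_comm, dist_eq_norm] at h1
    have h2 : G y - (P y - v) = (G y - P y) + v := by abel
    rw [h2]
    linarith [norm_add_le (G y - P y) v]
  let Ψ : E → E := fun y ↦ c + max 1 (η / ‖y - c‖) • (y - c)
  have hΨfar : ∀ y, η ≤ dist y c → Ψ y = y := by
    intro y hy
    rw [dist_eq_norm] at hy
    simp only [Ψ]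
    rw [max_eq_left (div_le_one_of_le₀ hy (norm_nonneg _))]
    simp
  have hΨnear : ∀ y, y ≠ c → dist y c ≤ η → Ψ y ∈ sphere c η := by
    intro y hyc hy
    have hpos := norm_pos_iff.2 (sub_ne_zero.2 hyc)
    rw [dist_eq_norm] at hy
    rw [mem_sphere, dist_eq_norm]
    simp only [Ψ]
    rw [max_eq_right ((one_le_div hpos).2 hy), add_sub_cancel_left, norm_smul, norm_div, norm_norm,
      Real.norm_of_nonneg hη0.le, div_mul_cancel₀ _ hpos.ne']
  have hne : ∀ y ∈ f '' B, y ≠ c := fun y hy h ↦ hc (h ▸ hy)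
  have hΨcont : ContinuousOn Ψ (f '' B) := by
    refine continuousOn_const.add (ContinuousOn.smul (ContinuousOn.sup continuousOn_const
      (continuousOn_const.div (by fun_prop) fun y hy ↦ ?_)) (by fun_prop))
    exact norm_ne_zero_iff.2 (sub_ne_zero.2 (hne y hy))
  obtain ⟨y, hy, hy0⟩ := hstable (fun y ↦ P (Ψ y) - v)
    ((hP.continuous.comp_continuousOn hΨcont).sub continuousOn_const) (fun y hy ↦ by
      have h1 := hclose (Ψ y)
      have hδ4 : δ ≤ 1 / 4 := min_le_right _ _
      rcases le_total η (dist y c) with h | h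
      · rw [hΨfar y h] at h1 ⊢
        linarith
      · have h2 := hGsmall y h
        have h3 := hGsmall (Ψ y) (mem_sphere.1 (hΨnear y (hne y hy) h)).le
        have h4 : G y - (P (Ψ y) - v) = G y - G (Ψ y) + (G (Ψ y) - (P (Ψ y) - v)) := by abel
        rw [h4]
        linarith [norm_add_le (G y - G (Ψ y)) (G (Ψ y) - (P (Ψ y) - v)),
          norm_sub_le (G y) (G (Ψ y))])
  rcases le_total η (dist y c) with h | h
  · have h1 := hclose y
    rw [hΨfar y h] at hy0
    rw [hy0, sub_zero] at h1
    exact (h1.trans_le (min_le_left _ _)).not_ge (hδG y ⟨hy, h⟩)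
  · exact hv ⟨Ψ y, hΨnear y (hne y hy) h, sub_eq_zero.1 hy0⟩

/-- **Invariance of domain.** -/
theorem ContinuousOn.isOpen_image_of_injOn {U : Set E} (hU : IsOpen U) {f : E → E}
    (hf : ContinuousOn f U) (hinj : Set.InjOn f U) : IsOpen (f '' U) := by
  rw [isOpen_iff_mem_nhds]
  rintro _ ⟨x, hx, rfl⟩
  obtain ⟨r, hr, hrU⟩ := Metric.nhds_basis_closedBall.mem_iff.1 (hU.mem_nhds hx)
  let a : E → E := fun z ↦ x + r • z
  have ha : Set.MapsTo a (closedBall 0 1) U := by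
    intro z hz
    refine hrU ?_
    rw [mem_closedBall_zero_iff] at hz
    rw [mem_closedBall, dist_eq_norm, add_sub_cancel_left, norm_smul, Real.norm_of_nonneg hr.le]
    exact mul_le_of_le_one_right hr.le hz
  have hainj : Function.Injective a := fun z w h ↦ by
    simpa [a, hr.ne'] using h
  have h := mem_interior_image_closedBall (f := f ∘ a)
    (hf.comp (by fun_prop) ha) (hinj.comp hainj.injOn ha)
  have ha0 : a 0 = x := by simp [a]
  rw [Function.comp_apply, ha0, mem_interior_iff_mem_nhds] at h
  refine Filter.mem_of_superset h ?_
  rw [Set.image_comp]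
  exact Set.image_mono ha.image_subset

end Brouwer

end

section

open Filter Topology

theorem injective_radial {E : Type*} [NormedAddCommGroup E] [NormedSpace ℝ E] {c : ℝ → ℝ}
    (hc : ∀ t, 0 ≤ t → 0 < c t) (hmono : StrictMonoOn (fun t ↦ c t * t) (Set.Ici 0)) :
    Function.Injective fun x : E ↦ c ‖x‖ • x := by
  intro x y hxy
  have h : ‖x‖ = ‖y‖ := by
    refine hmono.injOn (norm_nonneg x) (norm_nonneg y) ?_
    have := congrArg norm hxy
    simpa [norm_smul, abs_of_pos (hc _ (norm_nonneg x)), abs_of_pos (hc _ (norm_nonneg y))]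
      using this
  simp only [h] at hxy
  exact smul_right_injective E (hc _ (norm_nonneg y)).ne' hxy

theorem exists_squeeze {E : Type*} [NormedAddCommGroup E] [NormedSpace ℝ E] (a : E) {r : ℝ}
    (hr : 0 < r) : ∃ s : E → E, Continuous s ∧ Function.Injective s ∧ (∀ x, s x ∈ ball a r) ∧
      ∀ x ∈ ball a (r / 2), s x = x := by
  let c : ℝ → ℝ := fun t ↦ r / max t (r / 2) - r ^ 2 / (4 * max t (r / 2) ^ 2)
  have hm : ∀ t, 0 < max t (r / 2) := fun t ↦ lt_max_of_lt_right (by positivity)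
  have hc1 : ∀ t, t ≤ r / 2 → c t = 1 := by
    intro t ht
    simp only [c]
    rw [max_eq_right ht]
    field_simp
    norm_num
  have hc2 : ∀ t, r / 2 < t → c t * t = r - r ^ 2 / (4 * t) := by
    intro t ht
    have : 0 < t := by linarith
    simp only [c]
    rw [max_eq_left ht.le]
    field_simp
  have hlt : ∀ t, r / 2 < t → r / 2 < r - r ^ 2 / (4 * t) := by
    intro t ht
    have : 0 < t := by linarith
    have : r ^ 2 / (4 * t) < r / 2 := by
      rw [div_lt_iff₀ (by positivity)]
      nlinarith
    linarith
  have hcpos : ∀ t, 0 ≤ t → 0 < c t := by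
    intro t ht0
    rcases le_or_gt t (r / 2) with ht | ht
    · simp [hc1 t ht]
    · have h := hlt t ht
      rw [← hc2 t ht] at h
      exact pos_of_mul_pos_left (by linarith : 0 < c t * t) ht0
  have hmono : StrictMonoOn (fun t ↦ c t * t) (Set.Ici 0) := by
    intro t _ u _ htu
    simp only
    rcases le_or_gt u (r / 2) with hu | hu
    · rw [hc1 u hu, hc1 t (htu.le.trans hu)]
      linarith
    · rw [hc2 u hu]
      rcases le_or_gt t (r / 2) with ht | ht
      · rw [hc1 t ht]
        linarith [hlt u hu]
      · rw [hc2 t ht]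
        have : 0 < t := by linarith
        have : r ^ 2 / (4 * u) < r ^ 2 / (4 * t) := by gcongr
        linarith
  have hcont : Continuous c := by
    have h1 : ∀ t, max t (r / 2) ≠ 0 := fun t ↦ (hm t).ne'
    have h2 : ∀ t, 4 * max t (r / 2) ^ 2 ≠ 0 := fun t ↦ by simp [h1]
    exact (continuous_const.div (by fun_prop) h1).sub (continuous_const.div (by fun_prop) h2)
  refine ⟨fun x ↦ a + c ‖x - a‖ • (x - a), by fun_prop, ?_, ?_, ?_⟩
  · intro x y hxy
    exact sub_left_injective (injective_radial hcpos hmono (add_right_injective a hxy))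
  · intro x
    rw [mem_ball, dist_eq_norm, add_sub_cancel_left, norm_smul,
      Real.norm_of_nonneg (hcpos _ (norm_nonneg _)).le]
    rcases le_or_gt ‖x - a‖ (r / 2) with h | h
    · rw [hc1 _ h]
      linarith
    · rw [hc2 _ h]
      have : 0 < ‖x - a‖ := by linarith
      have : 0 < r ^ 2 / (4 * ‖x - a‖) := by positivity
      linarith
  · intro x hx
    rw [mem_ball, dist_eq_norm] at hx
    simp [hc1 _ hx.le]

section BrownCore

variable {E : Type*} [NormedAddCommGroup E] [InnerProductSpace ℝ E] [FiniteDimensional ℝ E]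

theorem exists_lift_squeeze {f : E → E} (hf : Continuous f) {a : E} {r : ℝ} (hr : 0 < r)
    (hinj : Set.InjOn f (f ⁻¹' (ball a r \ {a}))) (hrange : ball a r ⊆ Set.range f) :
    ∃ s F : E → E, Continuous s ∧ Function.Injective s ∧ (∀ x, s x ∈ ball a r) ∧ s a = a ∧
      Continuous F ∧ (∀ x, f (F x) = s (f x)) ∧ ∀ x, f x = a → F x = x := by
  classical
  obtain ⟨s, hs, hsinj, hsr, hsid⟩ := exists_squeeze a hr
  have hsa : s a = a := hsid a (mem_ball_self (by positivity))
  choose g hg using fun x ↦ hrange (hsr (f x))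
  let F : E → E := fun x ↦ if f x ∈ ball a (r / 2) then x else g x
  have hF : ∀ x, f (F x) = s (f x) := by
    intro x
    simp only [F]
    split_ifs with h
    · exact (hsid _ h).symm
    · exact hg x
  have hFid : ∀ x, f x ∈ ball a (r / 2) → F x = x := fun x hx ↦ if_pos hx
  refine ⟨s, F, hs, hsinj, hsr, hsa, continuous_iff_continuousAt.2 fun x ↦ ?_, hF, fun x hx ↦
    hFid x (hx ▸ mem_ball_self (by positivity))⟩
  by_cases hxa : f x = a
  · have : F =ᶠ[𝓝 x] id := by
      filter_upwards [(isOpen_ball.preimage hf).mem_nhds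
        (show f x ∈ ball a (r / 2) from hxa ▸ mem_ball_self (by positivity))] with y hy
      exact hFid y hy
    exact continuousAt_id.congr this.symm
  · have hUo : IsOpen (f ⁻¹' (ball a r \ {a})) :=
      (isOpen_ball.sdiff isClosed_singleton).preimage hf
    have hFU : ∀ y, f y ≠ a → F y ∈ f ⁻¹' (ball a r \ {a}) := by
      intro y hy
      rw [Set.mem_preimage, hF]
      exact ⟨hsr _, fun h ↦ hy (hsinj (h.trans hsa.symm))⟩
    rw [ContinuousAt, tendsto_def]
    intro N hN
    obtain ⟨O, hON, hO, hxO⟩ := _root_.mem_nhds_iff.1 hN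
    have hopen := ContinuousOn.isOpen_image_of_injOn (hO.inter hUo) hf.continuousOn
      (hinj.mono Set.inter_subset_right)
    filter_upwards [(hopen.preimage (hs.comp hf)).mem_nhds ⟨F x, ⟨hxO, hFU x hxa⟩, hF x⟩,
      (isOpen_ne.preimage hf).mem_nhds hxa] with y hy hya
    obtain ⟨z, ⟨hzO, hzU⟩, hz⟩ := hy
    rw [Set.mem_preimage, hinj (hFU y hya) hzU ((hF y).trans hz.symm)]
    exact hON hzO

/-- If `f` is a closed continuous surjection of Euclidean space with at most two nontrivial fibres,
then each of them has arbitrarily small neighbourhoods which are open cells. -/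
theorem exists_cell_nhds_fiber {f : E → E} (hf : Continuous f) (hsurj : Function.Surjective f)
    (hclosed : IsClosedMap f) {a b : E} (hab : a ≠ b)
    (hinj : ∀ x y, f x = f y → x ≠ y → f x = a ∨ f x = b) {W : Set E} (hW : IsOpen W)
    (hbW : f ⁻¹' {b} ⊆ W) :
    ∃ k : E → E, Continuous k ∧ Function.Injective k ∧ (∀ x, k x ∈ W) ∧ ∀ x, f x = b → k x = x := by
  have hr : 0 < dist b a := dist_pos.2 hab.symm
  have hinjU : Set.InjOn f (f ⁻¹' (ball a (dist b a) \ {a})) := by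
    rintro x ⟨hx, hxa⟩ y - hxy
    by_contra hne
    rcases hinj x y hxy hne with h | h
    · exact hxa h
    · rw [h, mem_ball] at hx
      exact hx.false
  obtain ⟨s, F, hs, hsinj, hsr, hsa, hFc, hF, hFid⟩ :=
    exists_lift_squeeze hf hr hinjU fun x _ ↦ hsurj x
  have hFU : ∀ y, f y ≠ a → F y ∈ f ⁻¹' (ball a (dist b a) \ {a}) := by
    intro y hy
    rw [Set.mem_preimage, hF]
    exact ⟨hsr _, fun h ↦ hy (hsinj (h.trans hsa.symm))⟩
  obtain ⟨x₀, hx₀⟩ := hsurj b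
  have hFf : ∀ {x y}, F x = F y → f x = f y := by
    intro x y h
    refine hsinj ?_
    rw [← hF, ← hF, h]
  have hFb : ∀ x, F x = F x₀ ↔ f x = b := by
    refine fun x ↦ ⟨fun h ↦ (hFf h).trans hx₀, fun h ↦ ?_⟩
    exact hinjU (hFU _ (h.trans_ne hab.symm)) (hFU _ (hx₀.trans_ne hab.symm))
      (by rw [hF, hF, h, hx₀])
  have hFinj : ∀ x y, F x = F y → x ≠ y → f x = b := by
    intro x y h hne
    rcases hinj x y (hFf h) hne with h' | h'
    · exact (hne (by rw [← hFid x h', h, hFid y ((hFf h).symm.trans h')])).elim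
    · exact h'
  obtain ⟨V, hV, hbV, hVW⟩ : ∃ V : Set E, IsOpen V ∧ b ∈ V ∧ f ⁻¹' V ⊆ W := by
    refine ⟨(f '' Wᶜ)ᶜ, (hclosed _ hW.isClosed_compl).isOpen_compl, ?_, ?_⟩
    · rintro ⟨x, hx, hxb⟩
      exact hx (hbW hxb)
    · intro x hx
      by_contra hxW
      exact hx ⟨x, hxW, rfl⟩
  have hsV : IsOpen (s '' V) :=
    ContinuousOn.isOpen_image_of_injOn hV hs.continuousOn hsinj.injOn
  have hO : IsOpen (f ⁻¹' (ball a (dist b a) \ {a}) ∩ f ⁻¹' (s '' V)) :=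
    ((isOpen_ball.sdiff isClosed_singleton).preimage hf).inter (hsV.preimage hf)
  obtain ⟨ρ, hρ, hρO⟩ := Metric.isOpen_iff.1 hO (F x₀)
    ⟨hFU _ (hx₀.trans_ne hab.symm), b, hbV, by rw [hF, hx₀]⟩
  obtain ⟨s', k, -, hs'inj, hs'r, hs'p, hk, hFk, hkid⟩ := exists_lift_squeeze hFc hρ
    (by
      rintro x ⟨-, hx⟩ y - hxy
      by_contra hne
      exact hx ((hFb x).2 (hFinj x y hxy hne)))
    (by
      intro z hz
      obtain ⟨hzU, w, -, hwz⟩ := hρO hz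
      obtain ⟨x, rfl⟩ := hsurj w
      have hfx : f x ≠ a := by
        rintro h
        rw [h, hsa] at hwz
        exact hzU.2 hwz.symm
      exact ⟨x, hinjU (hFU x hfx) hzU ((hF x).trans hwz)⟩)
  refine ⟨k, hk, fun x y hxy ↦ ?_, fun x ↦ ?_, fun x hx ↦ hkid x ((hFb x).2 hx)⟩
  · by_contra hne
    have h : F x = F y := hs'inj (by rw [← hFk, ← hFk, hxy])
    have hx := (hFb x).2 (hFinj x y h hne)
    exact hne (by rw [← hkid x hx, hxy, hkid y (h ▸ hx)])
  · have h := hs'r (F x)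
    rw [← hFk] at h
    obtain ⟨-, w, hw, hwk⟩ := hρO h
    rw [hF] at hwk
    exact hVW (show f (k x) ∈ V from hsinj hwk ▸ hw)

end BrownCore

section Shrinking

variable {E : Type*} [NormedAddCommGroup E] [InnerProductSpace ℝ E] [FiniteDimensional ℝ E]

theorem exists_homeomorph_image_subset_ball {K : Set E} (hK : IsCompact K) {τ : ℝ} (hτ : 0 < τ) :
    ∃ (σ : E ≃ₜ E) (R : ℝ), (∀ x, R ≤ ‖x‖ → σ x = x) ∧ ∀ x ∈ K, σ x ∈ ball 0 τ := by
  obtain ⟨R, hR, hKR⟩ := hK.isBounded.subset_closedBall_lt 0 0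
  set l := min 1 (τ / (2 * R)) with hl
  have hl0 : 0 < l := by positivity
  let c : ℝ → ℝ := fun t ↦ max l (min 1 (t / R - 1))
  have hcpos : ∀ t, 0 < c t := fun t ↦ lt_max_of_lt_left hl0
  have hcmono : Monotone c := by
    intro s t hst
    simp only [c]
    gcongr
  have hmono : StrictMonoOn (fun t ↦ c t * t) (Set.Ici 0) := by
    intro s hs t _ hst
    have := hcmono hst.le
    calc c s * s ≤ c t * s := mul_le_mul_of_nonneg_right this hs
      _ < c t * t := mul_lt_mul_of_pos_left hst (hcpos t)
  have hfar : ∀ x : E, 2 * R ≤ ‖x‖ → c ‖x‖ • x = x := by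
    intro x hx
    have h : 1 ≤ ‖x‖ / R - 1 := by
      rw [le_sub_iff_add_le, le_div_iff₀ hR]
      linarith
    simp only [c]
    rw [min_eq_left h, max_eq_right (min_le_left _ _), one_smul]
  have hcont : Continuous fun x : E ↦ c ‖x‖ • x := by fun_prop
  have hinj := injective_radial (E := E) (fun t _ ↦ hcpos t) hmono
  have hopen : IsOpenMap fun x : E ↦ c ‖x‖ • x := fun U hU ↦
    ContinuousOn.isOpen_image_of_injOn hU hcont.continuousOn hinj.injOn
  have hrange : Set.range (fun x : E ↦ c ‖x‖ • x) =
      (fun x : E ↦ c ‖x‖ • x) '' closedBall 0 (2 * R) ∪ (ball 0 (2 * R))ᶜ := by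
    ext y
    constructor
    · rintro ⟨x, rfl⟩
      rcases le_total (2 * R) ‖x‖ with h | h
      · right
        simpa only [hfar x h, Set.mem_compl_iff, mem_ball_zero_iff, not_lt]
      · exact Or.inl ⟨x, by simpa using h, rfl⟩
    · rintro (⟨x, -, rfl⟩ | hy)
      · exact ⟨x, rfl⟩
      · exact ⟨y, hfar y (by simpa using hy)⟩
  have hclopen : IsClopen (Set.range fun x : E ↦ c ‖x‖ • x) := by
    refine ⟨?_, hopen.isOpen_range⟩
    rw [hrange]
    exact ((isCompact_closedBall _ _).image hcont).isClosed.union isOpen_ball.isClosed_compl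
  have hsurj : Function.Surjective fun x : E ↦ c ‖x‖ • x :=
    Set.range_eq_univ.1 (hclopen.eq_univ (Set.range_nonempty _))
  refine ⟨(Equiv.ofBijective _ ⟨hinj, hsurj⟩).toHomeomorphOfContinuousOpen hcont hopen, 2 * R,
    hfar, fun x hx ↦ ?_⟩
  have hxR : ‖x‖ ≤ R := by simpa using hKR hx
  have hc : c ‖x‖ = l := by
    refine max_eq_left ((min_le_right _ _).trans ?_)
    have : ‖x‖ / R ≤ 1 := (div_le_one hR).2 hxR
    linarith
  change c ‖x‖ • x ∈ ball 0 τ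
  rw [hc, mem_ball_zero_iff, norm_smul, Real.norm_of_nonneg hl0.le]
  calc l * ‖x‖ ≤ τ / (2 * R) * R := by gcongr; exact min_le_right _ _
    _ = τ / 2 := by field_simp
    _ < τ := by linarith

theorem exists_continuous_extension_of_isOpenEmbedding {X : Type*} [TopologicalSpace X] [T2Space X]
    {k : E → X} (hk : IsOpenEmbedding k) {σ : E → E} (hσ : Continuous σ) {R : ℝ}
    (hR : ∀ x, R ≤ ‖x‖ → σ x = x) :
    ∃ H : X → X, Continuous H ∧ (∀ e, H (k e) = k (σ e)) ∧ ∀ x ∉ Set.range k, H x = x := by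
  classical
  let H : X → X := fun x ↦ if h : x ∈ Set.range k then k (σ h.choose) else x
  have hHk : ∀ e, H (k e) = k (σ e) := by
    intro e
    have h : k e ∈ Set.range k := ⟨e, rfl⟩
    simp only [H]
    rw [dif_pos h, hk.injective h.choose_spec]
  have hHid : ∀ x ∉ Set.range k, H x = x := fun x hx ↦ dif_neg hx
  refine ⟨H, continuous_iff_continuousAt.2 fun x ↦ ?_, hHk, hHid⟩
  by_cases hx : x ∈ Set.range k
  · obtain ⟨e, rfl⟩ := hx
    rw [← hk.continuousAt_iff]
    have : H ∘ k = k ∘ σ := funext hHk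
    rw [this]
    exact (hk.continuous.comp hσ).continuousAt
  · have hC : IsClosed (k '' closedBall 0 R) :=
      ((isCompact_closedBall 0 R).image hk.continuous).isClosed
    have hxC : x ∈ (k '' closedBall 0 R)ᶜ := fun h ↦ hx (Set.image_subset_range _ _ h)
    refine continuousAt_id.congr ?_
    filter_upwards [hC.isOpen_compl.mem_nhds hxC] with y hy
    by_cases hyk : y ∈ Set.range k
    · obtain ⟨e, rfl⟩ := hyk
      have he : R ≤ ‖e‖ := by
        by_contra! h
        exact hy ⟨e, by simpa using h.le, rfl⟩
      rw [hHk, hR e he, id]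
    · exact (hHid y hyk).symm

theorem exists_homeomorph_extension_of_isOpenEmbedding {X : Type*} [TopologicalSpace X] [T2Space X]
    {k : E → X} (hk : IsOpenEmbedding k) (σ : E ≃ₜ E) {R : ℝ} (hR : ∀ x, R ≤ ‖x‖ → σ x = x) :
    ∃ H : X ≃ₜ X, (∀ e, H (k e) = k (σ e)) ∧ ∀ x ∉ Set.range k, H x = x := by
  obtain ⟨H, hH, hHk, hHid⟩ := exists_continuous_extension_of_isOpenEmbedding hk σ.continuous hR
  obtain ⟨H', hH', hHk', hHid'⟩ := exists_continuous_extension_of_isOpenEmbedding hk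
    σ.symm.continuous (R := R) fun x hx ↦ by rw [σ.symm_apply_eq, hR x hx]
  refine ⟨⟨⟨H, H', fun x ↦ ?_, fun x ↦ ?_⟩, hH, hH'⟩, hHk, hHid⟩
  · by_cases hx : x ∈ Set.range k
    · obtain ⟨e, rfl⟩ := hx
      rw [hHk, hHk', σ.symm_apply_apply]
    · rw [hHid x hx, hHid' x hx]
  · by_cases hx : x ∈ Set.range k
    · obtain ⟨e, rfl⟩ := hx
      rw [hHk', hHk, σ.apply_symm_apply]
    · rw [hHid' x hx, hHid x hx]

theorem isOpen_setOf_separating {X Y : Type*} [TopologicalSpace X] [CompactSpace X]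
    [TopologicalSpace Y] [T2Space Y] {K : Set (X × X)} (hK : IsClosed K) :
    IsOpen {u : C(X, Y) | ∀ p ∈ K, u p.1 ≠ u p.2} := by
  have hC : IsClosed {q : (X × X) × C(X, Y) | q.1 ∈ K ∧ q.2 q.1.1 = q.2 q.1.2} :=
    (hK.preimage continuous_fst).inter (isClosed_eq (by fun_prop) (by fun_prop))
  convert (isClosedMap_snd_of_compactSpace _ hC).isOpen_compl using 1
  ext u
  simp only [Set.mem_ofPred_eq, Set.mem_compl_iff, Set.mem_image, Prod.exists, not_exists, not_and,
    Prod.forall]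
  constructor
  · rintro h x x' v ⟨hK, hv⟩ rfl
    exact h x x' hK hv
  · intro h x x' hK hu
    exact h x x' u ⟨hK, hu⟩ rfl

/-- **Bing's shrinking criterion** for a single cellular fibre. -/
theorem nonempty_homeomorph_of_cell_nhds_fiber {X Y : Type*} [MetricSpace X] [CompactSpace X]
    [MetricSpace Y] (ψ : C(X, Y)) (hsurj : Function.Surjective ψ) (y₀ : Y)
    (hinj : ∀ x x', ψ x = ψ x' → x ≠ x' → ψ x = y₀)
    (hcell : ∀ W : Set X, IsOpen W → ψ ⁻¹' {y₀} ⊆ W →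
      ∃ k : E → X, IsOpenEmbedding k ∧ ψ ⁻¹' {y₀} ⊆ Set.range k ∧ Set.range k ⊆ W) :
    Nonempty (X ≃ₜ Y) := by
  have : CompactSpace Y := hsurj.compactSpace ψ.continuous
  let S : Set C(X, Y) := closure (Set.range fun h : X ≃ₜ X ↦ ψ.comp (h : C(X, X)))
  have hS : IsClosed S := isClosed_closure
  have : CompleteSpace S := hS.completeSpace_coe
  let G : ℕ → Set S := fun n ↦
    {u | ∀ p ∈ {p : X × X | 1 / ((n : ℝ) + 1) ≤ dist p.1 p.2}, u.1 p.1 ≠ u.1 p.2}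
  have hGo : ∀ n, IsOpen (G n) := fun n ↦
    (isOpen_setOf_separating (isClosed_le (by fun_prop) (by fun_prop))).preimage
      continuous_subtype_val
  have hcompB : IsCompact (ψ ⁻¹' {y₀}) := (isClosed_singleton.preimage ψ.continuous).isCompact
  have hGd : ∀ n, Dense (G n) := by
    intro n
    rw [Metric.dense_iff]
    rintro ⟨u, hu⟩ ε hε
    obtain ⟨_, ⟨h₀, rfl⟩, hu₀⟩ := Metric.mem_closure_iff.1 hu (ε / 2) (by positivity)
    obtain ⟨δ, hδ, hδh⟩ := Metric.uniformContinuous_iff.1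
      (CompactSpace.uniformContinuous_of_continuous h₀.symm.continuous) (1 / ((n : ℝ) + 1))
      (by positivity)
    obtain ⟨k, hk, hBk, hkW⟩ := hcell (ψ ⁻¹' ball y₀ (ε / 8)) (isOpen_ball.preimage ψ.continuous)
      (Set.preimage_mono (by simpa using by positivity))
    obtain ⟨τ, hτ, hτk⟩ := Metric.continuousAt_iff.1 (hk.continuous.continuousAt (x := 0)) (δ / 2)
      (by positivity)
    obtain ⟨σ, R, hσR, hσ⟩ := exists_homeomorph_image_subset_ball
      (hk.isInducing.isCompact_preimage' hcompB hBk) hτ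
    obtain ⟨H, hHk, hHid⟩ := exists_homeomorph_extension_of_isOpenEmbedding hk σ hσR
    have hHclose : ∀ x, dist (ψ (H.symm x)) (ψ x) ≤ ε / 4 := by
      intro x
      by_cases hx : x ∈ Set.range k
      · obtain ⟨e, rfl⟩ := hx
        have he : H.symm (k e) = k (σ.symm e) := by
          rw [H.symm_apply_eq, hHk, σ.apply_symm_apply]
        rw [he]
        have h1 : dist (ψ (k (σ.symm e))) y₀ < ε / 8 := hkW ⟨_, rfl⟩
        have h2 : dist (ψ (k e)) y₀ < ε / 8 := hkW ⟨_, rfl⟩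
        linarith [dist_triangle_right (ψ (k (σ.symm e))) (ψ (k e)) y₀]
      · have he : H.symm x = x := by rw [H.symm_apply_eq, hHid x hx]
        rw [he, dist_self]
        positivity
    refine ⟨⟨ψ.comp ((h₀.trans H.symm : X ≃ₜ X) : C(X, X)), subset_closure ⟨_, rfl⟩⟩, ?_, ?_⟩
    · rw [mem_ball, Subtype.dist_eq]
      have h1 : dist (ψ.comp ((h₀.trans H.symm : X ≃ₜ X) : C(X, X))) (ψ.comp (h₀ : C(X, X)))
          ≤ ε / 4 := (ContinuousMap.dist_le (by positivity)).2 fun x ↦ hHclose (h₀ x)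
      rw [dist_comm] at hu₀
      have := dist_triangle (ψ.comp ((h₀.trans H.symm : X ≃ₜ X) : C(X, X)))
        (ψ.comp (h₀ : C(X, X))) u
      linarith
    · rintro ⟨x, x'⟩ hxx' heq
      change ψ (H.symm (h₀ x)) = ψ (H.symm (h₀ x')) at heq
      have hne : x ≠ x' := by
        rintro rfl
        simp only [Set.mem_ofPred_eq, dist_self] at hxx'
        have : 0 < 1 / ((n : ℝ) + 1) := by positivity
        linarith
      have hne' : H.symm (h₀ x) ≠ H.symm (h₀ x') := by simpa using hne
      have hsmall : ∀ z, ψ (H.symm z) = y₀ → dist z (k 0) < δ / 2 := by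
        intro z hz
        obtain ⟨e, he⟩ := hBk (show H.symm z ∈ ψ ⁻¹' {y₀} from hz)
        have hze : z = k (σ e) := by rw [← hHk, he, H.apply_symm_apply]
        rw [hze]
        refine hτk (hσ e ?_)
        rw [Set.mem_preimage, he]
        exact hz
      have h1 := hsmall _ (hinj _ _ heq hne')
      have h2 := hsmall _ (hinj _ _ heq.symm hne'.symm)
      have h3 := hδh (a := h₀ x) (b := h₀ x')
        (by linarith [dist_triangle_right (h₀ x) (h₀ x') (k 0)])
      rw [h₀.symm_apply_apply, h₀.symm_apply_apply] at h3
      exact h3.not_ge hxx'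
  have : Nonempty S := ⟨⟨ψ, subset_closure ⟨Homeomorph.refl X, rfl⟩⟩⟩
  obtain ⟨⟨u, huS⟩, hu⟩ := (dense_iInter_of_isOpen_nat hGo hGd).nonempty
  have huinj : Function.Injective u := by
    intro x x' hxx'
    by_contra hne
    obtain ⟨n, hn⟩ := exists_nat_one_div_lt (dist_pos.2 hne)
    exact Set.mem_iInter.1 hu n (x, x') hn.le hxx'
  have husurj : Function.Surjective u := by
    intro y
    rw [← Set.mem_range, ← (isCompact_range u.continuous).isClosed.closure_eq,
      Metric.mem_closure_iff]
    intro ε hε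
    obtain ⟨_, ⟨h, rfl⟩, hh⟩ := Metric.mem_closure_iff.1 huS ε hε
    obtain ⟨x, hx⟩ := hsurj y
    refine ⟨_, ⟨h.symm x, rfl⟩, ?_⟩
    have := (ContinuousMap.dist_apply_le_dist (h.symm x)).trans_lt hh
    rw [dist_comm] at this
    simpa [hx] using this
  exact ⟨(u.continuous.isClosedEmbedding huinj).isEmbedding.toHomeomorphOfSurjective husurj⟩
end Shrinking

end

section

open Filter Topology Module

section Sphere

variable {n : ℕ} {V : Type*} [NormedAddCommGroup V] [InnerProductSpace ℝ V]
  [Fact (finrank ℝ V = n + 1)]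

theorem ContinuousOn.isOpen_image_sphere_of_injOn {U : Set (EuclideanSpace ℝ (Fin n))}
    (hU : IsOpen U) {f : EuclideanSpace ℝ (Fin n) → sphere (0 : V) 1}
    (hf : ContinuousOn f U) (hinj : Set.InjOn f U) : IsOpen (f '' U) := by
  rw [isOpen_iff_mem_nhds]
  rintro _ ⟨x, hx, rfl⟩
  let e := stereographic' n (-f x)
  have hxe : f x ∈ e.source := by
    simpa [e] using ne_neg_of_mem_unit_sphere ℝ (f x)
  let U' := U ∩ f ⁻¹' e.source
  have hU' : IsOpen U' := hf.isOpen_inter_preimage hU e.open_source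
  have ho : IsOpen ((e ∘ f) '' U') := by
    refine ContinuousOn.isOpen_image_of_injOn hU'
      (e.continuousOn.comp (hf.mono Set.inter_subset_left) Set.inter_subset_right) ?_
    intro y hy z hz hyz
    exact hinj hy.1 hz.1 (e.injOn hy.2 hz.2 hyz)
  refine Filter.mem_of_superset ((e.isOpen_inter_preimage ho).mem_nhds
    ⟨hxe, x, ⟨hx, hxe⟩, rfl⟩) ?_
  rintro y ⟨hy, z, hz, hzy⟩
  exact ⟨z, hz.1, e.injOn hz.2 hy hzy⟩

theorem isOpen_image_of_collar
    {Φ : C(sphere (0 : EuclideanSpace ℝ (Fin n)) 1 × Set.Icc (-1 : ℝ) 1, sphere (0 : V) 1)}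
    (hΦ : Function.Injective Φ)
    {O : Set (sphere (0 : EuclideanSpace ℝ (Fin n)) 1 × Set.Icc (-1 : ℝ) 1)} (hO : IsOpen O)
    (hO1 : ∀ p ∈ O, |(p.2 : ℝ)| < 1) : IsOpen (Φ '' O) := by
  classical
  rcases O.eq_empty_or_nonempty with rfl | ⟨⟨x₀, t₀⟩, -⟩
  · simp
  let N : EuclideanSpace ℝ (Fin n) → sphere (0 : EuclideanSpace ℝ (Fin n)) 1 := fun z ↦
    if h : z = 0 then x₀ else ⟨(‖z‖)⁻¹ • z, by simp [norm_smul, h]⟩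
  have hN : ∀ z ≠ 0, (N z : EuclideanSpace ℝ (Fin n)) = (‖z‖)⁻¹ • z := by
    intro z hz
    simp [N, hz]
  have hNc : ContinuousOn N {0}ᶜ := by
    rw [Topology.IsInducing.subtypeVal.continuousOn_iff]
    refine ContinuousOn.congr (f := fun z ↦ (‖z‖)⁻¹ • z) ?_ hN
    exact (ContinuousOn.inv₀ (by fun_prop) fun z hz ↦ norm_ne_zero_iff.2 hz).smul continuousOn_id
  let P : EuclideanSpace ℝ (Fin n) →
      sphere (0 : EuclideanSpace ℝ (Fin n)) 1 × Set.Icc (-1 : ℝ) 1 :=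
    fun z ↦ (N z, Set.projIcc (-1) 1 (by norm_num) (‖z‖ - 2))
  have hPc : ContinuousOn P {0}ᶜ :=
    hNc.prodMk (continuous_projIcc.comp (by fun_prop)).continuousOn
  let U : Set (EuclideanSpace ℝ (Fin n)) := ({0}ᶜ ∩ P ⁻¹' O) ∩ {z | 1 < ‖z‖ ∧ ‖z‖ < 3}
  have hU : IsOpen U := (hPc.isOpen_inter_preimage isOpen_compl_singleton hO).inter
    ((isOpen_lt continuous_const continuous_norm).inter
      (isOpen_lt continuous_norm continuous_const))
  have hproj : ∀ z ∈ U, ((P z).2 : ℝ) = ‖z‖ - 2 := by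
    rintro z ⟨-, h1, h2⟩
    simp only [P]
    rw [Set.projIcc_of_mem _ ⟨by linarith, by linarith⟩]
  have hPinj : Set.InjOn P U := by
    intro z hz w hw hzw
    have h1 : ‖z‖ = ‖w‖ := by
      have := hproj z hz
      rw [hzw, hproj w hw] at this
      linarith
    have h2 : (N z : EuclideanSpace ℝ (Fin n)) = N w :=
      congrArg (fun p ↦ (p.1 : EuclideanSpace ℝ (Fin n))) hzw
    rw [hN z hz.1.1, hN w hw.1.1, h1] at h2
    exact smul_right_injective _ (inv_ne_zero (norm_ne_zero_iff.2 hw.1.1)) h2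
  have himage : Φ '' O = (Φ ∘ P) '' U := by
    ext y
    constructor
    · rintro ⟨⟨x, t⟩, hp, rfl⟩
      have ht := abs_lt.1 (hO1 _ hp)
      simp only at ht
      have hx : ‖(x : EuclideanSpace ℝ (Fin n))‖ = 1 := norm_eq_of_mem_sphere x
      have hnorm : ‖((t : ℝ) + 2) • (x : EuclideanSpace ℝ (Fin n))‖ = t + 2 := by
        rw [norm_smul, hx, mul_one, Real.norm_of_nonneg (by linarith)]
      have hne : ((t : ℝ) + 2) • (x : EuclideanSpace ℝ (Fin n)) ≠ 0 := by
        rw [← norm_ne_zero_iff, hnorm]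
        linarith
      have hP : P (((t : ℝ) + 2) • (x : EuclideanSpace ℝ (Fin n))) = (x, t) := by
        refine Prod.ext (Subtype.ext ?_) ?_
        · change (N _ : EuclideanSpace ℝ (Fin n)) = x
          rw [hN _ hne, hnorm, inv_smul_smul₀ (by linarith)]
        · change Set.projIcc _ _ (by norm_num) _ = t
          rw [hnorm, add_sub_cancel_right, Set.projIcc_val]
      refine ⟨_, ⟨⟨hne, ?_⟩, ?_⟩, congrArg Φ hP⟩
      · rwa [Set.mem_preimage, hP]
      · rw [Set.mem_ofPred_eq, hnorm]
        constructor <;> linarith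
    · rintro ⟨z, hz, rfl⟩
      exact ⟨P z, hz.1.2, rfl⟩
  rw [himage]
  exact ContinuousOn.isOpen_image_sphere_of_injOn hU
    (Φ.continuous.comp_continuousOn (hPc.mono fun z hz ↦ hz.1.1))
    fun z hz w hw hzw ↦ hPinj hz hw (hΦ hzw)

theorem exists_collar_extension {Z : Type*} [TopologicalSpace Z]
    {Φ : C(sphere (0 : EuclideanSpace ℝ (Fin n)) 1 × Set.Icc (-1 : ℝ) 1, sphere (0 : V) 1)}
    (hΦ : Function.Injective Φ)
    {u : sphere (0 : EuclideanSpace ℝ (Fin n)) 1 × Set.Icc (-1 : ℝ) 1 → Z} (hu : Continuous u)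
    (z₀ : Z) (hz₀ : ∀ p, |(p.2 : ℝ)| = 1 → u p = z₀) :
    ∃ w : sphere (0 : V) 1 → Z, Continuous w ∧ (∀ p, w (Φ p) = u p) ∧
      ∀ y ∉ Set.range Φ, w y = z₀ := by
  classical
  let w : sphere (0 : V) 1 → Z := fun y ↦ if h : y ∈ Set.range Φ then u h.choose else z₀
  have hw : ∀ p, w (Φ p) = u p := by
    intro p
    have h : Φ p ∈ Set.range Φ := ⟨p, rfl⟩
    simp only [w]
    rw [dif_pos h, hΦ h.choose_spec]
  have hw₀ : ∀ y ∉ Set.range Φ, w y = z₀ := fun y hy ↦ dif_neg hy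
  refine ⟨w, ?_, hw, hw₀⟩
  have hemb : IsClosedEmbedding Φ := Φ.continuous.isClosedEmbedding hΦ
  let O : Set (sphere (0 : EuclideanSpace ℝ (Fin n)) 1 × Set.Icc (-1 : ℝ) 1) :=
    {p | |(p.2 : ℝ)| < 1}
  have hOo : IsOpen (Φ '' O) :=
    isOpen_image_of_collar hΦ (isOpen_lt (by fun_prop) (by fun_prop)) fun p hp ↦ hp
  have h1 : ContinuousOn w (Set.range Φ) := by
    rw [← Set.image_univ, hemb.isInducing.continuousOn_image_iff, show w ∘ Φ = u from funext hw]
    exact hu.continuousOn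
  have h2 : ContinuousOn w (Φ '' O)ᶜ := by
    refine ContinuousOn.congr (f := fun _ ↦ z₀) continuousOn_const fun y hy ↦ ?_
    by_cases hyr : y ∈ Set.range Φ
    · obtain ⟨p, rfl⟩ := hyr
      rw [hw]
      refine hz₀ p (le_antisymm (abs_le.2 p.2.2) ?_)
      by_contra! h
      exact hy ⟨p, h, rfl⟩
    · exact hw₀ y hyr
  have h3 := h1.union_of_isClosed h2 hemb.isClosed_range hOo.isClosed_compl
  rw [← continuousOn_univ]
  refine h3.mono fun y _ ↦ ?_
  by_cases hy : y ∈ Φ '' O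
  · exact Or.inl (Set.image_subset_range _ _ hy)
  · exact Or.inr hy

end Sphere

theorem IsPreconnected.exists_eq_intCast {X : Type*} [TopologicalSpace X] {S : Set X}
    (hS : IsPreconnected S) {h : X → ℝ} (hc : ContinuousOn h S)
    (h0 : ∀ x ∈ S, (h x : AddCircle (1 : ℝ)) = 0) : ∃ m : ℤ, ∀ x ∈ S, h x = m := by
  obtain ⟨y, hy, hhy⟩ := hS.eqOn_const_of_mapsTo (T := AddSubgroup.zmultiples (1 : ℝ))
    ⟨inferInstanceAs (DiscreteTopology (AddSubgroup.zmultiples (1 : ℝ)))⟩ hc (fun x hx ↦ by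
      obtain ⟨m, hm⟩ := AddCircle.coe_eq_zero_iff (1 : ℝ) |>.1 (h0 x hx)
      exact ⟨m, hm⟩) ⟨0, zero_mem _⟩
  obtain ⟨m, hm⟩ := hy
  refine ⟨m, fun x hx ↦ ?_⟩
  rw [hhy hx, Function.const_apply, ← hm]
  simp

theorem exists_lift_addCircle_of_union {X : Type*} [TopologicalSpace X] {U V : Set X}
    (hU : IsOpen U) (hV : IsOpen V) (hUV : U ∪ V = Set.univ) (hc : IsPreconnected (U ∩ V))
    {θ : X → AddCircle (1 : ℝ)} {g₁ g₂ : X → ℝ} (h₁ : ContinuousOn g₁ U) (h₂ : ContinuousOn g₂ V)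
    (hθ₁ : ∀ x ∈ U, (g₁ x : AddCircle (1 : ℝ)) = θ x)
    (hθ₂ : ∀ x ∈ V, (g₂ x : AddCircle (1 : ℝ)) = θ x) :
    ∃ G : X → ℝ, Continuous G ∧ ∀ x, (G x : AddCircle (1 : ℝ)) = θ x := by
  classical
  obtain ⟨m, hm⟩ := hc.exists_eq_intCast (h := fun x ↦ g₁ x - g₂ x)
    ((h₁.mono Set.inter_subset_left).sub (h₂.mono Set.inter_subset_right)) (fun x hx ↦ by
      rw [AddCircle.coe_sub, hθ₁ x hx.1, hθ₂ x hx.2, sub_self])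
  let G : X → ℝ := fun x ↦ if x ∈ U then g₁ x else g₂ x + m
  have hG₁ : ∀ x ∈ U, G x = g₁ x := fun x hx ↦ if_pos hx
  have hG₂ : ∀ x ∈ V, G x = g₂ x + m := by
    intro x hx
    by_cases hxU : x ∈ U
    · rw [hG₁ x hxU]
      linarith [hm x ⟨hxU, hx⟩]
    · exact if_neg hxU
  have hmem : ∀ x, x ∈ U ∨ x ∈ V := fun x ↦ by
    rw [← Set.mem_union, hUV]
    trivial
  have hm0 : ((m : ℝ) : AddCircle (1 : ℝ)) = 0 :=
    (AddCircle.coe_eq_zero_iff _).2 ⟨m, by simp⟩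
  refine ⟨G, ?_, fun x ↦ ?_⟩
  · rw [← continuousOn_univ, ← hUV]
    exact (h₁.congr hG₁).union_of_isOpen ((h₂.add continuousOn_const).congr hG₂) hU hV
  · rcases hmem x with hx | hx
    · rw [hG₁ x hx, hθ₁ x hx]
    · rw [hG₂ x hx, AddCircle.coe_add, hθ₂ x hx, hm0, add_zero]

theorem one_lt_rank_euclideanSpace {n : ℕ} (hn : 2 ≤ n) :
    1 < Module.rank ℝ (EuclideanSpace ℝ (Fin n)) := by
  rw [← Module.finrank_eq_rank, finrank_euclideanSpace_fin]
  exact_mod_cast hn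

section Sphere

variable {n : ℕ} {V : Type*} [NormedAddCommGroup V] [InnerProductSpace ℝ V]
  [Fact (finrank ℝ V = n + 1)]

theorem exists_lift_addCircle_compl_singleton (n : ℕ) [Fact (finrank ℝ V = n + 1)]
    {θ : sphere (0 : V) 1 → AddCircle (1 : ℝ)}
    (hθ : Continuous θ) (v : sphere (0 : V) 1) :
    ∃ g : sphere (0 : V) 1 → ℝ, ContinuousOn g {v}ᶜ ∧
      ∀ x ∈ ({v}ᶜ : Set _), (g x : AddCircle (1 : ℝ)) = θ x := by
  let e := stereographic' n v
  have hsymm : Continuous e.symm := by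
    rw [← continuousOn_univ]
    exact e.continuousOn_symm.mono (by simp [e])
  obtain ⟨t, ht⟩ := QuotientAddGroup.mk_surjective (θ (e.symm 0))
  obtain ⟨F, ⟨-, hF⟩, -⟩ := (AddCircle.isCoveringMap_coe (1 : ℝ)).existsUnique_continuousMap_lifts
    (A := EuclideanSpace ℝ (Fin n)) ⟨θ ∘ e.symm, hθ.comp hsymm⟩ 0 t ht
  refine ⟨F ∘ e, F.continuous.comp_continuousOn (e.continuousOn.mono (by simp [e])),
    fun x hx ↦ ?_⟩
  have h := congrFun hF (e x)
  have hx' : x ∈ e.source := by simpa [e] using hx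
  simpa [e.left_inv hx'] using h

theorem exists_lift_addCircle_sphere (hn : 2 ≤ n) {θ : sphere (0 : V) 1 → AddCircle (1 : ℝ)}
    (hθ : Continuous θ) :
    ∃ G : sphere (0 : V) 1 → ℝ, Continuous G ∧ ∀ x, (G x : AddCircle (1 : ℝ)) = θ x := by
  have : FiniteDimensional ℝ V := FiniteDimensional.of_fact_finrank_eq_succ n
  have : Nontrivial V := Module.nontrivial_of_finrank_pos (R := ℝ)
    (by rw [Fact.out (p := finrank ℝ V = n + 1)]; omega)
  obtain ⟨v⟩ : Nonempty (sphere (0 : V) 1) := (NormedSpace.sphere_nonempty.2 zero_le_one).to_subtype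
  obtain ⟨g₁, hg₁, hθ₁⟩ := exists_lift_addCircle_compl_singleton n hθ v
  obtain ⟨g₂, hg₂, hθ₂⟩ := exists_lift_addCircle_compl_singleton n hθ (-v)
  have hv : -v ≠ v := (ne_neg_of_mem_unit_sphere ℝ v).symm
  refine exists_lift_addCircle_of_union isOpen_compl_singleton isOpen_compl_singleton ?_ ?_
    hg₁ hg₂ hθ₁ hθ₂
  · rw [← Set.compl_inter, Set.singleton_inter_eq_empty.2 (by simpa using hv.symm),
      Set.compl_empty]
  · let e := stereographic' n v
    have himage : ({v}ᶜ ∩ {-v}ᶜ : Set (sphere (0 : V) 1)) = e.symm '' {e (-v)}ᶜ := by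
      ext y
      constructor
      · rintro ⟨hy, hy'⟩
        have hys : y ∈ e.source := by simpa [e] using hy
        refine ⟨e y, fun h ↦ hy' ?_, e.left_inv hys⟩
        exact e.injOn hys (by simpa [e] using hv) h
      · rintro ⟨z, hz, rfl⟩
        have h1 : e.symm z ∈ e.source := e.map_target (by simp [e])
        refine ⟨by simpa [e] using h1, fun h ↦ hz ?_⟩
        rw [Set.mem_singleton_iff] at h
        rw [Set.mem_singleton_iff, ← h, e.right_inv (by simp [e])]
    rw [himage]
    exact (isConnected_compl_singleton_of_one_lt_rank (one_lt_rank_euclideanSpace hn)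
      _).isPreconnected.image _ (e.continuousOn_symm.mono (by simp [e]))

/-- A bicollared sphere has a global level function. -/
theorem exists_collar_level (hn : 2 ≤ n)
    {Φ : C(sphere (0 : EuclideanSpace ℝ (Fin n)) 1 × Set.Icc (-1 : ℝ) 1, sphere (0 : V) 1)}
    (hΦ : Function.Injective Φ) :
    ∃ g : sphere (0 : V) 1 → ℝ, Continuous g ∧ (∀ y, |g y| ≤ 1) ∧ (∀ p, g (Φ p) = p.2) ∧
      ∀ y, |g y| < 1 → y ∈ Set.range Φ := by
  obtain ⟨θ, hθ, hθΦ, hθ0⟩ := exists_collar_extension hΦ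
    (u := fun p ↦ (((p.2 : ℝ) + 1) / 2 : ℝ)) (Z := AddCircle (1 : ℝ))
    ((AddCircle.continuous_mk' 1).comp (by fun_prop)) 0 (fun p hp ↦ by
      rw [AddCircle.coe_eq_zero_iff]
      rcases eq_or_eq_neg_of_abs_eq hp with h | h
      · exact ⟨1, by rw [h]; norm_num⟩
      · exact ⟨0, by rw [h]; norm_num⟩)
  obtain ⟨G, hG, hGθ⟩ := exists_lift_addCircle_sphere hn hθ
  have : PreconnectedSpace (sphere (0 : EuclideanSpace ℝ (Fin n)) 1) :=
    isPreconnected_iff_preconnectedSpace.1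
      (isPreconnected_sphere (one_lt_rank_euclideanSpace hn) 0 1)
  have : PreconnectedSpace (Set.Icc (-1 : ℝ) 1) :=
    isPreconnected_iff_preconnectedSpace.1 isPreconnected_Icc
  obtain ⟨m, hm⟩ := isPreconnected_univ.exists_eq_intCast
    (h := fun p : sphere (0 : EuclideanSpace ℝ (Fin n)) 1 × Set.Icc (-1 : ℝ) 1 ↦
      G (Φ p) - ((p.2 : ℝ) + 1) / 2) (by fun_prop) (fun p _ ↦ by
      rw [AddCircle.coe_sub, hGθ, hθΦ, sub_self])
  have hlevel : ∀ p, 2 * (G (Φ p) - m) - 1 = p.2 := fun p ↦ by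
    linarith [hm p trivial]
  refine ⟨fun y ↦ max (-1) (min 1 (2 * (G y - m) - 1)), by fun_prop, fun y ↦ ?_, fun p ↦ ?_,
    fun y hy ↦ ?_⟩
  · exact abs_le.2 ⟨le_max_left _ _, max_le (by norm_num) (min_le_left _ _)⟩
  · simp only
    rw [hlevel, min_eq_right p.2.2.2, max_eq_right p.2.2.1]
  · by_contra hyr
    have h := hGθ y
    rw [hθ0 y hyr, AddCircle.coe_eq_zero_iff] at h
    obtain ⟨j, hj⟩ := h
    simp only [← hj, zsmul_eq_mul, mul_one] at hy
    have hy' := abs_lt.1 hy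
    rcases le_or_gt j m with h | h
    · have h' : (j : ℝ) ≤ m := by exact_mod_cast h
      rw [min_eq_right (by linarith), max_eq_left (by linarith)] at hy'
      exact hy'.1.false
    · have h' : (m : ℝ) + 1 ≤ j := by exact_mod_cast h
      rw [min_eq_left (by linarith), max_eq_right (by norm_num)] at hy'
      exact hy'.2.false

end Sphere

section Sphere

variable {n : ℕ} {V V' : Type*} [NormedAddCommGroup V] [InnerProductSpace ℝ V]
  [Fact (finrank ℝ V = n + 1)] [NormedAddCommGroup V'] [InnerProductSpace ℝ V']
  [Fact (finrank ℝ V' = n + 1)]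

/-- Brown's theorem: if a map of spheres has exactly two nontrivial fibres, then these are
cellular. -/
theorem exists_cell_nhds_fiber_sphere {c : sphere (0 : V) 1 → sphere (0 : V') 1}
    (hc : Continuous c) (hsurj : Function.Surjective c) {a b : sphere (0 : V') 1} (hab : a ≠ b)
    (hinj : ∀ x y, c x = c y → x ≠ y → c x = a ∨ c x = b) {q : sphere (0 : V) 1}
    (hqa : c q ≠ a) (hqb : c q ≠ b) {W : Set (sphere (0 : V) 1)} (hW : IsOpen W)
    (hbW : c ⁻¹' {b} ⊆ W) :
    ∃ k : EuclideanSpace ℝ (Fin n) → sphere (0 : V) 1, IsOpenEmbedding k ∧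
      c ⁻¹' {b} ⊆ Set.range k ∧ Set.range k ⊆ W := by
  have : FiniteDimensional ℝ V := FiniteDimensional.of_fact_finrank_eq_succ n
  have : CompactSpace (sphere (0 : V) 1) := Metric.sphere.compactSpace 0 1
  let e := stereographic' n q
  let e' := stereographic' n (c q)
  have hes : ∀ {x}, x ∈ e.source ↔ x ≠ q := by simp [e]
  have hes' : ∀ {x}, x ∈ e'.source ↔ x ≠ c q := by simp [e']
  have het : ∀ z, z ∈ e.target := by simp [e]
  have het' : ∀ z, z ∈ e'.target := by simp [e']
  have hsymm : Continuous e.symm := by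
    rw [← continuousOn_univ]
    exact e.continuousOn_symm.mono fun z _ ↦ het z
  have hsymm' : Continuous e'.symm := by
    rw [← continuousOn_univ]
    exact e'.continuousOn_symm.mono fun z _ ↦ het' z
  have hcq : ∀ x, c x = c q → x = q := by
    intro x hx
    by_contra hne
    rcases hinj x q hx hne with h | h
    · exact hqa (hx ▸ h)
    · exact hqb (hx ▸ h)
  have hcs : ∀ {x}, x ≠ q → c x ∈ e'.source := fun hx ↦ hes'.2 fun h ↦ hx (hcq _ h)
  have hcsymm : ∀ z, c (e.symm z) ∈ e'.source := fun z ↦ hcs (hes.1 (e.map_target (het z)))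
  let f : EuclideanSpace ℝ (Fin n) → EuclideanSpace ℝ (Fin n) := fun z ↦ e' (c (e.symm z))
  have hf : Continuous f := by
    refine e'.continuousOn.comp_continuous (hc.comp hsymm) hcsymm
  have hfa : ∀ {z x}, x ∈ e'.source → (f z = e' x ↔ c (e.symm z) = x) := fun hx ↦
    ⟨fun h ↦ e'.injOn (hcsymm _) hx h, fun h ↦ congrArg e' h⟩
  have hfsurj : Function.Surjective f := by
    intro w
    obtain ⟨y, hy⟩ := hsurj (e'.symm w)
    have hyq : y ≠ q := by
      rintro rfl
      exact hes'.1 (e'.map_target (het' w)) hy.symm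
    refine ⟨e y, ?_⟩
    simp only [f]
    rw [e.left_inv (hes.2 hyq), hy, e'.right_inv (het' w)]
  have hfclosed : IsClosedMap f := by
    refine (isProperMap_iff_isCompact_preimage.2 ⟨hf, fun K hK ↦ ?_⟩).isClosedMap
    have hK' : IsCompact (c ⁻¹' (e'.symm '' K)) :=
      ((hK.image hsymm').isClosed.preimage hc).isCompact
    have hsub : c ⁻¹' (e'.symm '' K) ⊆ e.source := by
      rintro x ⟨z, -, hz⟩
      rw [hes]
      rintro rfl
      exact hes'.1 (e'.map_target (het' z)) hz
    convert hK'.image_of_continuousOn (e.continuousOn.mono hsub) using 1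
    ext z
    constructor
    · intro hz
      exact ⟨e.symm z, ⟨f z, hz, e'.left_inv (hcsymm z)⟩, e.right_inv (het z)⟩
    · rintro ⟨x, ⟨w, hw, hwx⟩, rfl⟩
      have hx : x ∈ e.source := hsub ⟨w, hw, hwx⟩
      change e' (c (e.symm (e x))) ∈ K
      rwa [e.left_inv hx, ← hwx, e'.right_inv (het' w)]
  have hab' : e' a ≠ e' b := fun h ↦ hab (e'.injOn (hes'.2 hqa.symm) (hes'.2 hqb.symm) h)
  obtain ⟨k, hk, hkinj, hkW, hkb⟩ := exists_cell_nhds_fiber hf hfsurj hfclosed hab'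
    (fun x y hxy hne ↦ by
      rw [hfa (hes'.2 hqa.symm), hfa (hes'.2 hqb.symm)]
      exact hinj _ _ (e'.injOn (hcsymm x) (hcsymm y) hxy)
        fun h ↦ hne (e.symm.injOn (het x) (het y) h))
    (hW.preimage hsymm) (by
      intro z hz
      exact hbW ((hfa (hes'.2 hqb.symm)).1 hz))
  have hemb : IsOpenEmbedding e.symm := e.symm.isOpenEmbedding (Set.eq_univ_of_forall het)
  have hkemb : IsOpenEmbedding k := .of_continuous_injective_isOpenMap hk hkinj fun U hU ↦
    ContinuousOn.isOpen_image_of_injOn hU hk.continuousOn hkinj.injOn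
  refine ⟨e.symm ∘ k, hemb.comp hkemb, fun x hx ↦ ?_, ?_⟩
  · have hxq : x ≠ q := by
      rintro rfl
      exact hqb hx
    have h : f (e x) = e' b := by
      rw [hfa (hes'.2 hqb.symm), e.left_inv (hes.2 hxq)]
      exact hx
    exact ⟨e x, by rw [Function.comp_apply, hkb _ h, e.left_inv (hes.2 hxq)]⟩
  · rintro _ ⟨z, rfl⟩
    exact hkW z

theorem exists_mem_sphere_norm_smul_eq {F : Type*} [NormedAddCommGroup F] [NormedSpace ℝ F]
    (x₀ : sphere (0 : F) 1) (w : F) : ∃ x : sphere (0 : F) 1, ‖w‖ • (x : F) = w := by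
  by_cases hw : w = 0
  · exact ⟨x₀, by simp [hw]⟩
  · exact ⟨⟨(‖w‖)⁻¹ • w, by simp [norm_smul, hw]⟩,
      smul_inv_smul₀ (norm_ne_zero_iff.2 hw) w⟩

theorem exists_cell_nhds_sublevel (hn : 2 ≤ n)
    {Φ : C(sphere (0 : EuclideanSpace ℝ (Fin n)) 1 × Set.Icc (-1 : ℝ) 1, sphere (0 : V) 1)}
    (hΦ : Function.Injective Φ) {g : sphere (0 : V) 1 → ℝ} (hg : Continuous g)
    (hg1 : ∀ y, |g y| ≤ 1) (hgΦ : ∀ p, g (Φ p) = p.2) (hgr : ∀ y, |g y| < 1 → y ∈ Set.range Φ)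
    {W : Set (sphere (0 : V) 1)} (hW : IsOpen W) (hgW : ∀ y, g y = -1 → y ∈ W) :
    ∃ k : EuclideanSpace ℝ (Fin n) → sphere (0 : V) 1, IsOpenEmbedding k ∧
      (∀ y, g y = -1 → y ∈ Set.range k) ∧ Set.range k ⊆ W := by
  have : Fact (finrank ℝ (WithLp 2 (EuclideanSpace ℝ (Fin n) × ℝ)) = n + 1) :=
    ⟨by rw [(WithLp.linearEquiv 2 ℝ (EuclideanSpace ℝ (Fin n) × ℝ)).finrank_eq]; simp⟩
  have : Nontrivial (EuclideanSpace ℝ (Fin n)) := Module.nontrivial_of_finrank_pos (R := ℝ)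
    (by rw [finrank_euclideanSpace_fin]; omega)
  obtain ⟨x₀⟩ : Nonempty (sphere (0 : EuclideanSpace ℝ (Fin n)) 1) :=
    (NormedSpace.sphere_nonempty.2 zero_le_one).to_subtype
  obtain ⟨m, hm, hmΦ, hm0⟩ := exists_collar_extension hΦ
    (u := fun p ↦ √(1 - (p.2 : ℝ) ^ 2) • (p.1 : EuclideanSpace ℝ (Fin n))) (by fun_prop) 0
    (fun p hp ↦ by rw [← sq_abs, hp]; simp)
  have hnorm : ∀ y, ‖m y‖ ^ 2 + g y ^ 2 = 1 := by
    intro y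
    by_cases hy : y ∈ Set.range Φ
    · obtain ⟨⟨x, t⟩, rfl⟩ := hy
      have ht : 0 ≤ 1 - (t : ℝ) ^ 2 := by nlinarith [t.2.1, t.2.2]
      rw [hmΦ, hgΦ, norm_smul, norm_eq_of_mem_sphere, mul_one, Real.norm_of_nonneg (by positivity),
        Real.sq_sqrt ht]
      ring
    · have h : |g y| = 1 := le_antisymm (hg1 y) (not_lt.1 fun h ↦ hy (hgr y h))
      rw [hm0 y hy, ← sq_abs (g y), h]
      simp
  let c : sphere (0 : V) 1 → sphere (0 : WithLp 2 (EuclideanSpace ℝ (Fin n) × ℝ)) 1 := fun y ↦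
    ⟨WithLp.toLp 2 (m y, g y), by
      rw [mem_sphere_zero_iff_norm, ← sq_eq_sq₀ (norm_nonneg _) zero_le_one,
        WithLp.prod_norm_sq_eq_of_L2]
      simpa using hnorm y⟩
  have hc : Continuous c := by
    refine Continuous.subtype_mk ?_ _
    exact (WithLp.prod_continuous_toLp 2 _ _).comp (hm.prodMk hg)
  have hceq : ∀ y y', c y = c y' ↔ m y = m y' ∧ g y = g y' := by
    intro y y'
    simp [c, Subtype.ext_iff, WithLp.ext_iff, Prod.ext_iff]
  have hpole : ∀ y y', |g y| = 1 → g y = g y' → c y = c y' := by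
    intro y y' h h'
    have h0 : ∀ z, |g z| = 1 → m z = 0 := by
      intro z hz
      have := hnorm z
      rw [← sq_abs (g z), hz] at this
      simpa using this
    exact (hceq _ _).2 ⟨by rw [h0 y h, h0 y' (h' ▸ h)], h'⟩
  have hgc : ∀ {y y'}, c y = c y' → g y = g y' := fun h ↦ ((hceq _ _).1 h).2
  have ht : ∀ t : ℝ, t ∈ Set.Icc (-1 : ℝ) 1 → ∃ y ∈ Set.range Φ, g y = t := fun t ht ↦
    ⟨Φ (x₀, ⟨t, ht⟩), ⟨_, rfl⟩, hgΦ _⟩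
  obtain ⟨yp, -, hyp⟩ := ht 1 (by simp)
  obtain ⟨ym, -, hym⟩ := ht (-1) (by simp)
  obtain ⟨q, -, hq⟩ := ht 0 (by simp)
  have hfib : ∀ y, c y = c ym ↔ g y = -1 := fun y ↦
    ⟨fun h ↦ (hgc h).trans hym, fun h ↦ hpole _ _ (by rw [h]; simp) (h.trans hym.symm)⟩
  have hsurj : Function.Surjective c := by
    rintro ⟨z, hz⟩
    rw [mem_sphere_zero_iff_norm, ← sq_eq_sq₀ (norm_nonneg _) zero_le_one,
      WithLp.prod_norm_sq_eq_of_L2, Real.norm_eq_abs, sq_abs] at hz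
    obtain ⟨x, hx⟩ := exists_mem_sphere_norm_smul_eq x₀ z.fst
    have hs : |z.snd| ≤ 1 := abs_le_one_iff_mul_self_le_one.2 (by nlinarith [sq_nonneg ‖z.fst‖])
    refine ⟨Φ (x, ⟨z.snd, abs_le.1 hs⟩), Subtype.ext ?_⟩
    have hsq : 1 - z.snd ^ 2 = ‖z.fst‖ ^ 2 := by linarith
    simp only [c, hmΦ, hgΦ, hsq, Real.sqrt_sq (norm_nonneg _), hx]
    rfl
  obtain ⟨k, hk, hbk, hkW⟩ := exists_cell_nhds_fiber_sphere (n := n) hc hsurj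
    (a := c yp) (b := c ym) (q := q)
    (fun h ↦ by have := hgc h; rw [hyp, hym] at this; norm_num at this)
    (fun y y' hyy' hne ↦ by
      by_cases h : |g y| < 1
      · obtain ⟨h1, h2⟩ := (hceq _ _).1 hyy'
        obtain ⟨⟨x, t⟩, rfl⟩ := hgr y h
        obtain ⟨⟨x', t'⟩, rfl⟩ := hgr y' (h2 ▸ h)
        rw [hgΦ, hgΦ] at h2
        obtain rfl : t = t' := Subtype.ext h2
        rw [hgΦ] at h
        rw [hmΦ, hmΦ] at h1
        have ht : 0 < 1 - (t : ℝ) ^ 2 := sub_pos.2 ((sq_lt_one_iff_abs_lt_one _).2 h)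
        obtain rfl : x = x' :=
          Subtype.ext (smul_right_injective _ (Real.sqrt_ne_zero'.2 ht) h1)
        exact (hne rfl).elim
      · have h1 : |g y| = 1 := le_antisymm (hg1 y) (not_lt.1 h)
        rcases eq_or_eq_neg_of_abs_eq h1 with h2 | h2
        · exact Or.inl (hpole _ _ h1 (h2.trans hyp.symm))
        · exact Or.inr (hpole _ _ h1 (h2.trans hym.symm)))
    (fun h ↦ by have := hgc h; rw [hq, hyp] at this; norm_num at this)
    (fun h ↦ by have := hgc h; rw [hq, hym] at this; norm_num at this)
    hW (fun y hy ↦ hgW y ((hfib y).1 hy))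
  exact ⟨k, hk, fun y hy ↦ hbk ((hfib y).2 hy), hkW⟩

end Sphere

theorem closure_sublevel {S X : Type*} [TopologicalSpace S] [TopologicalSpace X]
    {Φ : C(S × Set.Icc (-1 : ℝ) 1, X)} {g : X → ℝ} (hg : Continuous g) (hgΦ : ∀ p, g (Φ p) = p.2)
    (hgr : ∀ y, |g y| < 1 → y ∈ Set.range Φ) :
    closure {y | g y < 0} = {y | g y ≤ 0} := by
  refine Set.Subset.antisymm (closure_lt_subset_le hg continuous_const) fun y hy ↦ ?_
  rcases lt_or_eq_of_le (show g y ≤ 0 from hy) with h | h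
  · exact subset_closure h
  obtain ⟨⟨x, t⟩, rfl⟩ := hgr y (by rw [h]; simp)
  rw [hgΦ] at h
  let P : ℝ → X := fun s ↦ Φ (x, Set.projIcc (-1) 1 (by norm_num) s)
  have hP : Continuous P := Φ.continuous.comp (by fun_prop)
  have hP0 : P 0 = Φ (x, t) := by
    simp only [P]
    rw [← h]
    simp only [Set.projIcc_val]
  have hmaps : Set.MapsTo P (Set.Iio 0) {y | g y < 0} := by
    intro s hs
    rw [Set.mem_ofPred_eq, hgΦ, Set.coe_projIcc]
    exact max_lt (by norm_num) (min_lt_of_right_lt hs)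
  rw [← hP0]
  exact map_mem_closure hP (by rw [closure_Iio]; exact Set.mem_Iic.2 le_rfl) hmaps

section Sphere

variable {n : ℕ} {V : Type*} [NormedAddCommGroup V] [InnerProductSpace ℝ V]
  [Fact (finrank ℝ V = n + 1)]

theorem nonempty_homeomorph_sublevel (hn : 2 ≤ n)
    {Φ : C(sphere (0 : EuclideanSpace ℝ (Fin n)) 1 × Set.Icc (-1 : ℝ) 1, sphere (0 : V) 1)}
    (hΦ : Function.Injective Φ) {g : sphere (0 : V) 1 → ℝ} (hg : Continuous g)
    (hg1 : ∀ y, |g y| ≤ 1) (hgΦ : ∀ p, g (Φ p) = p.2) (hgr : ∀ y, |g y| < 1 → y ∈ Set.range Φ) :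
    Nonempty ({y | g y ≤ 0} ≃ₜ closedBall (0 : EuclideanSpace ℝ (Fin n)) 1) := by
  have : FiniteDimensional ℝ V := FiniteDimensional.of_fact_finrank_eq_succ n
  have : Nontrivial (EuclideanSpace ℝ (Fin n)) := Module.nontrivial_of_finrank_pos (R := ℝ)
    (by rw [finrank_euclideanSpace_fin]; omega)
  obtain ⟨x₀⟩ : Nonempty (sphere (0 : EuclideanSpace ℝ (Fin n)) 1) :=
    (NormedSpace.sphere_nonempty.2 zero_le_one).to_subtype
  have : CompactSpace (sphere (0 : V) 1) := Metric.sphere.compactSpace 0 1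
  have hX : IsClosed {y | g y ≤ 0} := isClosed_le hg continuous_const
  have : CompactSpace {y | g y ≤ 0} := isCompact_iff_compactSpace.1 hX.isCompact
  obtain ⟨m, hm, hmΦ, hm0⟩ := exists_collar_extension hΦ
    (u := fun p ↦ (1 - |(p.2 : ℝ)|) • (p.1 : EuclideanSpace ℝ (Fin n))) (by fun_prop) 0
    (fun p hp ↦ by simp [hp])
  have hnorm : ∀ y, ‖m y‖ = 1 - |g y| := by
    intro y
    by_cases hy : y ∈ Set.range Φ
    · obtain ⟨p, rfl⟩ := hy
      rw [hmΦ, hgΦ, norm_smul, norm_eq_of_mem_sphere, mul_one, Real.norm_of_nonneg]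
      exact sub_nonneg.2 (abs_le.2 p.2.2)
    · have h : |g y| = 1 := le_antisymm (hg1 y) (not_lt.1 fun h ↦ hy (hgr y h))
      rw [hm0 y hy, h]
      simp
  let ψ : C({y | g y ≤ 0}, closedBall (0 : EuclideanSpace ℝ (Fin n)) 1) :=
    ⟨fun y ↦ ⟨m y, by
      rw [mem_closedBall_zero_iff, hnorm]
      linarith [abs_nonneg (g y)]⟩, by fun_prop⟩
  have hfib : ∀ y, ψ y = ⟨0, by simp⟩ ↔ g y = -1 := by
    intro y
    have h0 : g y ≤ 0 := y.2
    rw [Subtype.ext_iff]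
    change m y = 0 ↔ _
    rw [← norm_eq_zero, hnorm, abs_of_nonpos h0]
    constructor <;> intro h <;> linarith
  refine nonempty_homeomorph_of_cell_nhds_fiber (E := EuclideanSpace ℝ (Fin n)) ψ ?_
    ⟨0, by simp⟩ ?_ ?_
  · rintro ⟨w, hw⟩
    obtain ⟨x, hx⟩ := exists_mem_sphere_norm_smul_eq x₀ w
    rw [mem_closedBall_zero_iff] at hw
    have ht : ‖w‖ - 1 ∈ Set.Icc (-1 : ℝ) 1 := ⟨by linarith [norm_nonneg w], by linarith⟩
    refine ⟨⟨Φ (x, ⟨‖w‖ - 1, ht⟩), ?_⟩, Subtype.ext ?_⟩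
    · rw [Set.mem_ofPred_eq, hgΦ]
      linarith
    · change m _ = w
      rw [hmΦ]
      simp only
      rw [abs_of_nonpos (by linarith)]
      simpa using hx
  · rintro ⟨y, hy⟩ ⟨y', hy'⟩ hyy' hne
    rw [Set.mem_ofPred_eq] at hy hy'
    have h : m y = m y' := congrArg Subtype.val hyy'
    rw [hfib]
    by_contra hgy
    change g y ≠ -1 at hgy
    have h1 : g y = g y' := by
      have := hnorm y
      rw [h, hnorm, abs_of_nonpos hy, abs_of_nonpos hy'] at this
      linarith
    have h2 : |g y| < 1 := by
      rw [abs_lt]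
      exact ⟨lt_of_le_of_ne (abs_le.1 (hg1 y)).1 hgy.symm, by linarith⟩
    obtain ⟨⟨x, t⟩, rfl⟩ := hgr y h2
    obtain ⟨⟨x', t'⟩, rfl⟩ := hgr y' (h1 ▸ h2)
    rw [hgΦ, hgΦ] at h1
    obtain rfl : t = t' := Subtype.ext h1
    rw [hgΦ] at h2
    rw [hmΦ, hmΦ] at h
    obtain rfl : x = x' :=
      Subtype.ext (smul_right_injective _ (sub_pos.2 h2).ne' h)
    exact hne rfl
  · intro W hW hBW
    obtain ⟨O, hO, rfl⟩ := isOpen_induced_iff.1 hW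
    obtain ⟨k, hk, hkB, hkW⟩ := exists_cell_nhds_sublevel hn hΦ hg hg1 hgΦ hgr
      (hO.inter (isOpen_lt hg (continuous_const (y := (0 : ℝ))))) (fun y hy ↦ by
        have h0 : g y ≤ 0 := by linarith
        refine ⟨hBW (a := ⟨y, h0⟩) ((hfib _).2 hy), ?_⟩
        rw [Set.mem_ofPred_eq]
        linarith)
    have hkX : ∀ z, k z ∈ {y | g y ≤ 0} := fun z ↦ by
      have h : g (k z) < 0 := (hkW ⟨z, rfl⟩).2
      rw [Set.mem_ofPred_eq]
      exact h.le
    have hrange : Set.range (Set.codRestrict k _ hkX) = Subtype.val ⁻¹' Set.range k := by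
      ext y
      simp [Subtype.ext_iff]
    refine ⟨Set.codRestrict k _ hkX, ⟨hk.isEmbedding.codRestrict _ hkX, ?_⟩, ?_, ?_⟩
    · rw [hrange]
      exact hk.isOpen_range.preimage continuous_subtype_val
    · rw [hrange]
      exact fun y hy ↦ hkB y ((hfib y).1 hy)
    · rw [hrange]
      exact fun y hy ↦ (hkW hy).1

theorem isPreconnected_sublevel (hn : 2 ≤ n)
    {Φ : C(sphere (0 : EuclideanSpace ℝ (Fin n)) 1 × Set.Icc (-1 : ℝ) 1, sphere (0 : V) 1)}
    (hΦ : Function.Injective Φ) {g : sphere (0 : V) 1 → ℝ} (hg : Continuous g)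
    (hg1 : ∀ y, |g y| ≤ 1) (hgΦ : ∀ p, g (Φ p) = p.2) (hgr : ∀ y, |g y| < 1 → y ∈ Set.range Φ) :
    IsPreconnected {y | g y < 0} := by
  have : Nontrivial (EuclideanSpace ℝ (Fin n)) := Module.nontrivial_of_finrank_pos (R := ℝ)
    (by rw [finrank_euclideanSpace_fin]; omega)
  obtain ⟨x₀⟩ : Nonempty (sphere (0 : EuclideanSpace ℝ (Fin n)) 1) :=
    (NormedSpace.sphere_nonempty.2 zero_le_one).to_subtype
  have : PreconnectedSpace (sphere (0 : EuclideanSpace ℝ (Fin n)) 1) :=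
    isPreconnected_iff_preconnectedSpace.1
      (isPreconnected_sphere (one_lt_rank_euclideanSpace hn) 0 1)
  obtain ⟨k, hk, hkB, hkW⟩ := exists_cell_nhds_sublevel hn hΦ hg hg1 hgΦ hgr
    (isOpen_lt hg (continuous_const (y := (0 : ℝ)))) (fun y hy ↦ by
      rw [Set.mem_ofPred_eq]
      linarith)
  let T : Set (Set.Icc (-1 : ℝ) 1) := {t | (t : ℝ) < 0}
  have hT : IsPreconnected T := by
    rw [← Topology.IsInducing.subtypeVal.isPreconnected_image]
    convert isPreconnected_Ico (a := (-1 : ℝ)) (b := 0) using 1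
    ext t
    exact ⟨fun ⟨u, hu, h⟩ ↦ h ▸ ⟨u.2.1, hu⟩, fun ht ↦ ⟨⟨t, ht.1, by linarith [ht.2]⟩, ht.2, rfl⟩⟩
  have hcollar : IsPreconnected (Φ '' (Set.univ ×ˢ T)) :=
    (isPreconnected_univ.prod hT).image _ Φ.continuous.continuousOn
  have hp : Φ (x₀, ⟨-1, by simp⟩) ∈ Φ '' (Set.univ ×ˢ T) :=
    ⟨(x₀, ⟨-1, by simp⟩), ⟨trivial, show (-1 : ℝ) < 0 by norm_num⟩, rfl⟩
  have h := (isPreconnected_range hk.continuous).union _ (hkB _ (hgΦ _)) hp hcollar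
  convert h using 1
  ext y
  constructor
  · intro hy
    rw [Set.mem_ofPred_eq] at hy
    rcases eq_or_ne (g y) (-1) with h1 | h1
    · exact Or.inl (hkB y h1)
    · have h2 : |g y| < 1 := by
        rw [abs_lt]
        exact ⟨lt_of_le_of_ne (abs_le.1 (hg1 y)).1 h1.symm, by linarith⟩
      obtain ⟨p, rfl⟩ := hgr y h2
      rw [hgΦ] at hy
      exact Or.inr ⟨p, ⟨trivial, hy⟩, rfl⟩
  · rintro (hy | ⟨p, ⟨-, hp⟩, rfl⟩)
    · exact hkW hy
    · rw [Set.mem_ofPred_eq, hgΦ]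
      exact hp

theorem nonempty_homeomorph_closure_connectedComponentIn (hn : 2 ≤ n)
    {Φ : C(sphere (0 : EuclideanSpace ℝ (Fin n)) 1 × Set.Icc (-1 : ℝ) 1, sphere (0 : V) 1)}
    (hΦ : Function.Injective Φ) {g : sphere (0 : V) 1 → ℝ} (hg : Continuous g)
    (hg1 : ∀ y, |g y| ≤ 1) (hgΦ : ∀ p, g (Φ p) = p.2) (hgr : ∀ y, |g y| < 1 → y ∈ Set.range Φ)
    {x : sphere (0 : V) 1} (hx : g x < 0) :
    Nonempty (closure (connectedComponentIn {y | g y ≠ 0} x) ≃ₜ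
      closedBall (0 : EuclideanSpace ℝ (Fin n)) 1) := by
  have hcomp : connectedComponentIn {y | g y ≠ 0} x = {y | g y < 0} := by
    refine Set.Subset.antisymm ?_ ((isPreconnected_sublevel hn hΦ hg hg1 hgΦ
      hgr).subset_connectedComponentIn hx fun y hy ↦ ne_of_lt hy)
    refine isPreconnected_connectedComponentIn.subset_left_of_subset_union
      (isOpen_lt hg continuous_const) (isOpen_lt continuous_const hg)
      (Set.disjoint_left.2 fun y (h : g y < 0) (h' : 0 < g y) ↦ (h.trans h').false)
      (fun y hy ↦ lt_or_gt_of_ne (connectedComponentIn_subset _ _ hy))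
      ⟨x, mem_connectedComponentIn (ne_of_lt hx), hx⟩
  rw [hcomp, closure_sublevel hg hgΦ hgr]
  exact nonempty_homeomorph_sublevel hn hΦ hg hg1 hgΦ hgr

end Sphere

end

/-- **generalized Schoenflies theorem.** Let `φ : S^{n-1} → S^n` be a
locally flat topological embedding with `n ≥ 2` (i.e. `φ` extends to an embedding of
the thickened sphere `S^{n-1} × [-1,1]`), and let `A` be the closure of a connected
component of `S^n \ φ(S^{n-1})`.  Then `A` is homeomorphic to the closed `n`-ball. -/
theorem stmt6 (n : ℕ) (hn : 2 ≤ n)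
    (φ : C(↥(sphere (0 : EuclideanSpace ℝ (Fin n)) 1),
          ↥(sphere (0 : EuclideanSpace ℝ (Fin (n + 1))) 1)))
    (hφ : Function.Injective φ)
    (hflat : ∃ Φ : C(↥(sphere (0 : EuclideanSpace ℝ (Fin n)) 1) × ↥(Set.Icc (-1 : ℝ) 1),
            ↥(sphere (0 : EuclideanSpace ℝ (Fin (n + 1))) 1)),
        Function.Injective Φ ∧
        ∀ x, Φ (x, ⟨0, by norm_num⟩) = φ x)
    (x : ↥(sphere (0 : EuclideanSpace ℝ (Fin (n + 1))) 1))
    (hx : x ∈ (Set.range φ)ᶜ)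
    (A : Set ↥(sphere (0 : EuclideanSpace ℝ (Fin (n + 1))) 1))
    (hA : A = closure (connectedComponentIn (Set.range φ)ᶜ x)) :
    Nonempty (↥A ≃ₜ ↥(closedBall (0 : EuclideanSpace ℝ (Fin n)) 1)) := by
  have : Fact (Module.finrank ℝ (EuclideanSpace ℝ (Fin (n + 1))) = n + 1) :=
    ⟨finrank_euclideanSpace_fin⟩
  obtain ⟨Φ, hΦ, hΦφ⟩ := hflat
  obtain ⟨g, hg, hg1, hgΦ, hgr⟩ := exists_collar_level hn hΦ
  have hrange : (Set.range φ)ᶜ = {y | g y ≠ 0} := by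
    ext y
    rw [Set.mem_compl_iff, Set.mem_ofPred_eq, not_iff_not]
    constructor
    · rintro ⟨z, rfl⟩
      rw [← hΦφ, hgΦ]
    · intro hy
      obtain ⟨⟨z, t⟩, rfl⟩ := hgr y (by rw [hy]; simp)
      rw [hgΦ] at hy
      obtain rfl : t = ⟨0, by norm_num⟩ := Subtype.ext hy
      exact ⟨z, (hΦφ z).symm⟩
  rw [hrange] at hx
  rw [hA, hrange]
  rcases lt_or_gt_of_ne hx with h | h
  · exact nonempty_homeomorph_closure_connectedComponentIn hn hΦ hg hg1 hgΦ hgr h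
  · let ν : Set.Icc (-1 : ℝ) 1 → Set.Icc (-1 : ℝ) 1 := fun t ↦
      ⟨-t, by linarith [t.2.2], by linarith [t.2.1]⟩
    have hν : Continuous ν := by fun_prop
    have hνν : ∀ t, ν (ν t) = t := fun t ↦ Subtype.ext (neg_neg _)
    let Φ' : C(sphere (0 : EuclideanSpace ℝ (Fin n)) 1 × Set.Icc (-1 : ℝ) 1,
        sphere (0 : EuclideanSpace ℝ (Fin (n + 1))) 1) :=
      ⟨fun p ↦ Φ (p.1, ν p.2), by fun_prop⟩
    have hΦ' : Function.Injective Φ' := by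
      rintro ⟨z, t⟩ ⟨z', t'⟩ hzz
      have h1 := Prod.ext_iff.1 (hΦ hzz)
      refine Prod.ext h1.1 ?_
      rw [← hνν t, ← hνν t']
      exact congrArg ν h1.2
    have hneg : {y | g y ≠ 0} = {y | -g y ≠ 0} := by simp
    rw [hneg]
    refine nonempty_homeomorph_closure_connectedComponentIn hn hΦ' hg.neg
      (fun y ↦ by rw [Pi.neg_apply, abs_neg]; exact hg1 y) (fun p ↦ ?_) (fun y hy ↦ ?_)
      (neg_neg_of_pos h)
    · change -g (Φ (p.1, ν p.2)) = p.2
      rw [hgΦ]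
      exact neg_neg _
    · rw [Pi.neg_apply, abs_neg] at hy
      obtain ⟨⟨z, t⟩, rfl⟩ := hgr y hy
      exact ⟨(z, ν t), by change Φ (z, ν (ν t)) = _; rw [hνν]⟩
end
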